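/- Assume d ≥ 5. There exists a constant c > 0 such that for any n ≥ 2, ζ > 0 and T ≥ 1 satisfying T ≤ ζ/2 and ζ ≥ (n log n)/T, one has P(Cap(R_n) − E[Cap(R_n)] ≤ −ζ) ≤ 2T exp(−c ζ/T) + P(ξ_n(T) ≥ c ζ). -/

import Mathlib

open Filter Finset MeasureTheory
open scoped symmDiff ENNReal

namespace SRW

/-- Vertices of `ℤ^d`. -/
abbrev V (d : ℕ) : Type := Fin d → ℤ

/-- The set of nearest-neighbor steps (the `2d` unit vectors `±e_i`) in `ℤ^d`. -/
def steps (d : ℕ) : Finset (V d) :=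
  (Finset.univ : Finset (Fin d × Bool)).image
    (fun p j => if j = p.1 then (if p.2 then 1 else -1) else 0)

/-- Position at time `k` of the walk started at `x` with step sequence `s`. -/
def pos {d : ℕ} (x : V d) (s : ℕ → V d) (k : ℕ) : V d :=
  x + ∑ i ∈ Finset.range k, s i

open Classical in
/-- Probability, for the simple random walk, of an event depending on the
first `n` steps (steps beyond `n` are set to `0`): each of the `(2d)^n`
admissible step sequences has equal probability. -/
noncomputable def probN (d n : ℕ) (P : (ℕ → V d) → Prop) : ℝ :=
  (((Fintype.piFinset fun _ : Fin n => steps d).filter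
      (fun s => P fun i => if h : i < n then s ⟨i, h⟩ else 0)).card : ℝ) / ((2 * d : ℕ) : ℝ) ^ n

/-- Expectation of a functional of the first `n` steps of the walk. -/
noncomputable def expN (d n : ℕ) (f : (ℕ → V d) → ℝ) : ℝ :=
  (∑ s ∈ Fintype.piFinset fun _ : Fin n => steps d,
      f fun i => if h : i < n then s ⟨i, h⟩ else 0) / ((2 * d : ℕ) : ℝ) ^ n

/-- Escape probability `P_x(H_A^+ = ∞)`: the walk started at `x` never
hits `A` at a positive time (decreasing limit of the finite-horizon events). -/
noncomputable def esc (d : ℕ) (A : Set (V d)) (x : V d) : ℝ :=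
  ⨅ n : ℕ, probN d n (fun s => ∀ k, 1 ≤ k → k ≤ n → pos x s k ∉ A)

/-- Newtonian capacity `Cap(A) = Σ_{x∈A} P_x(H_A^+ = ∞)`. -/
noncomputable def cap {d : ℕ} (A : Finset (V d)) : ℝ :=
  ∑ x ∈ A, esc d (↑A) x

/-- Green's function `G(z) = Σ_n P_0(S_n = z)`. -/
noncomputable def G (d : ℕ) (z : V d) : ℝ :=
  ∑' n : ℕ, probN d n (fun s => pos 0 s n = z)

/-- Truncated Green's function `G_T(z) = Σ_{n≤T} P_0(S_n = z)`. -/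
noncomputable def GT (d T : ℕ) (z : V d) : ℝ :=
  ∑ n ∈ Finset.range (T + 1), probN d n (fun s => pos 0 s n = z)

/-- Convolution `(G ⋆ G_T)(x) = Σ_y G(x-y) G_T(y)`. -/
noncomputable def GconvGT (d T : ℕ) (x : V d) : ℝ :=
  ∑' y : V d, G d (x - y) * GT d T y

/-- Euclidean norm on `ℤ^d`. -/
noncomputable def nrm {d : ℕ} (x : V d) : ℝ :=
  Real.sqrt (∑ i, ((x i : ℝ)) ^ 2)

/-- The range `{S_k : k ∈ I}` of the walk started at `x` over the set of times `I`. -/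
noncomputable def rangeOn {d : ℕ} (x : V d) (s : ℕ → V d) (I : Finset ℕ) : Finset (V d) :=
  I.image (pos x s)

/-- Probability that the walk started at `z` hits both `A` and `B` in finite time
(increasing limit of the finite-horizon probabilities). -/
noncomputable def hitBothProb (d : ℕ) (A B : Finset (V d)) (z : V d) : ℝ :=
  ⨆ n : ℕ, probN d n (fun s => (∃ k ≤ n, pos z s k ∈ A) ∧ (∃ k ≤ n, pos z s k ∈ B))

/-- The discrete cube `Q(x,r) = [x - r/2, x + r/2)^d ∩ ℤ^d`. -/
def cube {d : ℕ} (x : V d) (r : ℝ) : Set (V d) :=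
  {y | ∀ i, (x i : ℝ) - r / 2 ≤ (y i : ℝ) ∧ (y i : ℝ) < (x i : ℝ) + r / 2}

/-- The corrector `ξ_n(T)`. -/
noncomputable def xi (d n T : ℕ) (s : ℕ → V d) : ℝ :=
  ∑ k ∈ Finset.range (n + 1), ∑ x ∈ rangeOn 0 s (Finset.Icc 0 k),
    esc d (↑(rangeOn 0 s (Finset.Icc 0 k))) x * (GconvGT d T (x - pos 0 s k) / T)

/-- The capacity cross-term `χ_C(A,B) = Cap(A) + Cap(B) - Cap(A ∪ B)`. -/
noncomputable def chiC {d : ℕ} (A B : Finset (V d)) : ℝ := cap A + cap B - cap (A ∪ B)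

open Classical in
/-- Conditional expectation, given the first `m` steps (equal to those of `s`),
of a functional of the first `n` steps. -/
noncomputable def condExpN (d n m : ℕ) (f : (ℕ → V d) → ℝ) (s : ℕ → V d) : ℝ :=
  expN d n (fun s' => if ∀ i < m, s' i = s i then f s' else 0) * ((2 * d : ℕ) : ℝ) ^ m

/-- The compensator `ξ_n^*(T)`. -/
noncomputable def xiStar (d n T : ℕ) (s : ℕ → V d) : ℝ :=
  (1 / (T : ℝ)) * ∑ j ∈ Finset.range T, ∑ l ∈ Finset.Icc 1 (n / T - 1),
    condExpN d (n + T) (j + l * T)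
      (fun s' => chiC (rangeOn 0 s' (Finset.Icc j (j + l * T)))
        (rangeOn 0 s' (Finset.Icc (j + l * T) (j + (l + 1) * T)))) s

/-- `E[Cap(R_n)]`, the expected capacity of the range up to time `n`. -/
noncomputable def expCapRange (d n : ℕ) : ℝ :=
  expN d n (fun s => cap (rangeOn 0 s (Finset.Icc 0 n)))

/-- The maximal capacity `c_n` of the range of a nearest-neighbor path with `n` steps. -/
noncomputable def maxPathCap (d n : ℕ) : ℝ :=
  sSup {y : ℝ | ∃ (x : V d) (s : ℕ → V d), (∀ i, s i ∈ steps d) ∧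
    y = cap (rangeOn x s (Finset.Icc 0 n))}

/-- `Γ(A,Λ) = Σ_{x∈A} Σ_{y∈Λ} G(y-x) P_y(H_Λ^+ = ∞)`. -/
noncomputable def GamFin (d : ℕ) (A : Finset (V d)) (Λ : Set (V d)) : ℝ :=
  ∑ x ∈ A, ∑' y : Λ, G d ((y : V d) - x) * esc d Λ (y : V d)

/-- `P(Γ(R̃_∞, Λ) > t)`, as the increasing limit of the finite-horizon probabilities. -/
noncomputable def PGam (d : ℕ) (Λ : Set (V d)) (t : ℝ) : ℝ :=
  ⨆ N : ℕ, probN d N (fun s => t < GamFin d (rangeOn 0 s (Finset.Icc 0 N)) Λ)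

/-- `E_x[Γ(R̃_∞, Λ)]`, as the increasing limit of the finite-horizon expectations. -/
noncomputable def EGam (d : ℕ) (x : V d) (Λ : Set (V d)) : ℝ :=
  ⨆ N : ℕ, expN d N (fun s => GamFin d (rangeOn x s (Finset.Icc 0 N)) Λ)

/-- The law of the first `n` steps of two independent simple random walks:
uniform measure on pairs of admissible step sequences of length `n`. -/
noncomputable def pairLevel (d n : ℕ) : Measure ((Fin n → V d) × (Fin n → V d)) :=
  (((2 * d : ℕ) : ℝ≥0∞) ^ (2 * n))⁻¹ •
    ∑ a ∈ Fintype.piFinset fun _ : Fin n => steps d,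
      ∑ b ∈ Fintype.piFinset fun _ : Fin n => steps d, Measure.dirac (a, b)

open Classical in
/-- `Γ(R̃_∞, R_∞) = Σ_{x ∈ R̃_∞} Σ_{y ∈ R_∞} G(y-x) P_y(H_{R_∞}^+ = ∞)` for
two (step sequences of) walks, with values in `ℝ≥0∞`. -/
noncomputable def gammaInf (d : ℕ) (sA sB : ℕ → V d) : ℝ≥0∞ :=
  ∑' x : V d, ∑' y : V d,
    if x ∈ Set.range (pos (0 : V d) sA) ∧ y ∈ Set.range (pos (0 : V d) sB) then
      ENNReal.ofReal (G d (y - x) * esc d (Set.range (pos (0 : V d) sB)) y)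
    else 0

/-! ### Expectations over finitely many steps -/

/-- Prepend a step to a step sequence. -/
def consStep {d : ℕ} (e : V d) (s : ℕ → V d) : ℕ → V d
  | 0 => e
  | i + 1 => s i

/-- The first `m` steps of `s` followed by the steps of `t`. -/
def joinSteps {d : ℕ} (m : ℕ) (s t : ℕ → V d) : ℕ → V d :=
  fun i => if i < m then s i else t (i - m)

/-- Extension by zero of a finite sequence of steps. -/
def extSteps {d n : ℕ} (s : Fin n → V d) : ℕ → V d :=
  fun i => if h : i < n then s ⟨i, h⟩ else 0

lemma expN_eq {d n : ℕ} (f : (ℕ → V d) → ℝ) :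
    expN d n f = (∑ s ∈ Fintype.piFinset fun _ : Fin n => steps d, f (extSteps s)) /
      ((2 * d : ℕ) : ℝ) ^ n := rfl

lemma steps_injective (d : ℕ) : Function.Injective
    (fun (p : Fin d × Bool) (j : Fin d) => if j = p.1 then (if p.2 then (1 : ℤ) else -1) else 0) := by
  rintro ⟨i, a⟩ ⟨j, b⟩ h
  have h1 := congrFun h i
  by_cases hij : i = j
  · subst hij
    cases a <;> cases b <;> simp at h1 ⊢
  · simp [hij] at h1
    cases a <;> simp at h1

lemma card_steps (d : ℕ) : (steps d).card = 2 * d := by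
  unfold steps
  rw [Finset.card_image_of_injective _ (steps_injective d)]
  simp [mul_comm]

lemma neg_mem_steps {d : ℕ} {e : V d} (he : e ∈ steps d) : -e ∈ steps d := by
  unfold steps at *
  simp only [Finset.mem_image, Finset.mem_univ, true_and, Prod.exists] at *
  obtain ⟨i, b, rfl⟩ := he
  refine ⟨i, !b, ?_⟩
  ext j
  by_cases h : j = i <;> cases b <;> simp [h]

lemma expN_zero {d : ℕ} (f : (ℕ → V d) → ℝ) : expN d 0 f = f (fun _ => 0) := by
  rw [expN_eq]
  simp only [pow_zero, div_one]
  rw [Fintype.piFinset_of_isEmpty, Fintype.sum_unique]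
  congr 1

lemma extSteps_cons {d n : ℕ} (e : V d) (s : Fin n → V d) :
    extSteps (Fin.cons e s : Fin (n + 1) → V d) = consStep e (extSteps s) := by
  funext i
  cases i with
  | zero => simp [extSteps, consStep]
  | succ i =>
    simp only [extSteps, consStep, Nat.add_lt_add_iff_right]
    split_ifs with h
    · exact Fin.cons_succ (α := fun _ => V d) e s ⟨i, h⟩
    · rfl

lemma expN_succ {d n : ℕ} (f : (ℕ → V d) → ℝ) :
    expN d (n + 1) f =
      (∑ e ∈ steps d, expN d n (fun s => f (consStep e s))) / ((2 * d : ℕ) : ℝ) := by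
  simp only [expN_eq]
  rw [← Finset.sum_div, div_div, ← pow_succ, ← Finset.sum_product']
  congr 1
  refine Finset.sum_bij' (fun s _ => (s 0, Fin.tail s)) (fun p _ => Fin.cons p.1 p.2) ?_ ?_ ?_ ?_ ?_
  · intro s hs
    simp only [Fintype.mem_piFinset, Finset.mem_product] at *
    exact ⟨hs 0, fun i => hs i.succ⟩
  · rintro ⟨e, s⟩ hs
    simp only [Fintype.mem_piFinset, Finset.mem_product] at *
    intro i
    refine Fin.cases ?_ ?_ i
    · exact hs.1
    · intro j; exact hs.2 j
  · intro s _
    exact Fin.cons_self_tail s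
  · rintro ⟨e, s⟩ _
    simp
  · intro s _
    simp only []
    rw [← extSteps_cons, Fin.cons_self_tail]

lemma expN_add {d n : ℕ} (f g : (ℕ → V d) → ℝ) :
    expN d n (fun s => f s + g s) = expN d n f + expN d n g := by
  simp [expN_eq, Finset.sum_add_distrib, add_div]

lemma expN_sub {d n : ℕ} (f g : (ℕ → V d) → ℝ) :
    expN d n (fun s => f s - g s) = expN d n f - expN d n g := by
  simp [expN_eq, Finset.sum_sub_distrib, sub_div]

lemma expN_const_mul {d n : ℕ} (c : ℝ) (f : (ℕ → V d) → ℝ) :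
    expN d n (fun s => c * f s) = c * expN d n f := by
  simp [expN_eq, ← Finset.mul_sum, mul_div_assoc]

lemma expN_mul_const {d n : ℕ} (c : ℝ) (f : (ℕ → V d) → ℝ) :
    expN d n (fun s => f s * c) = expN d n f * c := by
  simp_rw [mul_comm _ c, expN_const_mul]

lemma expN_sum {d n : ℕ} {ι : Type*} (I : Finset ι) (f : ι → (ℕ → V d) → ℝ) :
    expN d n (fun s => ∑ i ∈ I, f i s) = ∑ i ∈ I, expN d n (f i) := by
  simp only [expN_eq]
  rw [Finset.sum_comm, Finset.sum_div]

lemma expN_mono {d n : ℕ} {f g : (ℕ → V d) → ℝ} (h : ∀ s, f s ≤ g s) :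
    expN d n f ≤ expN d n g := by
  simp only [expN_eq]
  gcongr
  exact h _

lemma expN_nonneg {d n : ℕ} {f : (ℕ → V d) → ℝ} (h : ∀ s, 0 ≤ f s) : 0 ≤ expN d n f := by
  rw [expN_eq]
  exact div_nonneg (Finset.sum_nonneg fun s _ => h _) (by positivity)

lemma expN_const {d n : ℕ} (hd : 0 < d) (c : ℝ) : expN d n (fun _ => c) = c := by
  have : ((2 * d : ℕ) : ℝ) ≠ 0 := by positivity
  rw [expN_eq]
  simp only [Finset.sum_const, Fintype.card_piFinset, card_steps, Finset.prod_const,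
    Finset.card_univ, Fintype.card_fin, nsmul_eq_mul, Nat.cast_pow]
  field_simp

lemma joinSteps_zero {d : ℕ} (s t : ℕ → V d) : joinSteps 0 s t = t := by
  funext i; simp [joinSteps]

lemma joinSteps_cons {d m : ℕ} (e : V d) (s t : ℕ → V d) :
    joinSteps (m + 1) (consStep e s) t = consStep e (joinSteps m s t) := by
  funext i
  cases i with
  | zero => simp [joinSteps, consStep]
  | succ i => simp [joinSteps, consStep]

/-- Independence of the first `m` steps and the following `n` steps. -/
lemma expN_join {d m n : ℕ} (f : (ℕ → V d) → ℝ) :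
    expN d (m + n) f = expN d m (fun s => expN d n (fun t => f (joinSteps m s t))) := by
  induction m generalizing f with
  | zero => simp [expN_zero, joinSteps_zero]
  | succ m ih =>
    rw [show m + 1 + n = (m + n) + 1 by ring, expN_succ, expN_succ]
    simp only [ih, joinSteps_cons]

/-- The first `m` steps of `s` in reverse order. -/
def revSteps {d : ℕ} (m : ℕ) (s : ℕ → V d) : ℕ → V d :=
  fun i => if i < m then s (m - 1 - i) else 0

lemma expN_rev {d m : ℕ} (f : (ℕ → V d) → ℝ) :
    expN d m f = expN d m (fun s => f (revSteps m s)) := by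
  simp only [expN_eq]
  congr 1
  refine Finset.sum_bij' (fun s _ => s ∘ Fin.rev) (fun s _ => s ∘ Fin.rev) ?_ ?_ ?_ ?_ ?_
  · intro s hs
    simp only [Fintype.mem_piFinset] at *
    exact fun i => hs _
  · intro s hs
    simp only [Fintype.mem_piFinset] at *
    exact fun i => hs _
  · intro s _; ext; simp
  · intro s _; ext; simp
  · intro s _
    congr 1
    funext i
    simp only [extSteps, revSteps]
    split_ifs with h1 h2
    · simp only [Function.comp]
      congr 1
      ext
      simp [Fin.rev]
      omega
    · omega
    · rfl

lemma expN_neg {d m : ℕ} (f : (ℕ → V d) → ℝ) :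
    expN d m f = expN d m (fun s => f (-s)) := by
  simp only [expN_eq]
  congr 1
  refine Finset.sum_bij' (fun s _ => -s) (fun s _ => -s) ?_ ?_ ?_ ?_ ?_
  · intro s hs
    simp only [Fintype.mem_piFinset] at *
    exact fun i => neg_mem_steps (hs _)
  · intro s hs
    simp only [Fintype.mem_piFinset] at *
    exact fun i => neg_mem_steps (hs _)
  · intro s _; simp
  · intro s _; simp
  · intro s _
    congr 1
    funext i
    simp only [extSteps, Pi.neg_apply]
    split_ifs with h1 <;> simp

open Classical in
lemma probN_eq {d n : ℕ} (P : (ℕ → V d) → Prop) :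
    probN d n P = expN d n (fun s => if P s then 1 else 0) := by
  rw [expN_eq, probN, Finset.sum_boole]
  rfl

lemma pos_zero {d : ℕ} (x : V d) (s : ℕ → V d) : pos x s 0 = x := by simp [pos]

lemma pos_cons {d : ℕ} (x e : V d) (s : ℕ → V d) (k : ℕ) :
    pos x (consStep e s) (k + 1) = pos (x + e) s k := by
  simp only [pos, Finset.sum_range_succ', consStep]
  abel

lemma pos_eq_add {d : ℕ} (x : V d) (s : ℕ → V d) (k : ℕ) : pos x s k = x + pos 0 s k := by
  simp [pos]

lemma pos_neg {d : ℕ} (x : V d) (s : ℕ → V d) (k : ℕ) : pos x (-s) k = x - pos 0 s k := by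
  simp [pos, sub_eq_add_neg]

lemma pos_join_le {d m k : ℕ} (x : V d) (s t : ℕ → V d) (h : k ≤ m) :
    pos x (joinSteps m s t) k = pos x s k := by
  simp only [pos]
  congr 1
  apply Finset.sum_congr rfl
  intro i hi
  have : i < m := by have := Finset.mem_range.1 hi; omega
  simp [joinSteps, this]

lemma pos_join_add {d m k : ℕ} (x : V d) (s t : ℕ → V d) :
    pos x (joinSteps m s t) (m + k) = pos (pos x s m) t k := by
  rw [← pos_join_le (m := m) x s t le_rfl]
  simp only [pos, Finset.sum_range_add, add_assoc]
  congr 2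
  apply Finset.sum_congr rfl
  intro i hi
  simp [joinSteps]

lemma pos_rev {d m k : ℕ} (s : ℕ → V d) (h : k ≤ m) :
    pos 0 (revSteps m s) k = pos 0 s m - pos 0 s (m - k) := by
  obtain ⟨j, rfl⟩ := Nat.exists_eq_add_of_le h
  simp only [pos, zero_add, Nat.add_sub_cancel_left]
  rw [add_comm k j, Finset.sum_range_add, add_sub_cancel_left, ← Finset.sum_range_reflect]
  apply Finset.sum_congr rfl
  intro i hi
  have := Finset.mem_range.1 hi
  simp only [revSteps]
  rw [if_pos (by omega)]
  congr 1
  omega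

/-- A functional of the first `m` steps has the same expectation over longer horizons. -/
lemma expN_of_local {d m n : ℕ} (hd : 0 < d) {f : (ℕ → V d) → ℝ}
    (hf : ∀ s t, f (joinSteps m s t) = f s) (h : m ≤ n) : expN d n f = expN d m f := by
  obtain ⟨k, rfl⟩ := Nat.exists_eq_add_of_le h
  rw [expN_join]
  simp [hf, expN_const hd]

/-! ### The heat kernel -/

/-- The heat kernel `P_0(S_n = z)`. -/
noncomputable def hk (d n : ℕ) (z : V d) : ℝ := probN d n (fun s => pos 0 s n = z)

lemma hk_eq {d n : ℕ} (z : V d) :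
    hk d n z = expN d n (fun s => if pos 0 s n = z then 1 else 0) := by
  rw [hk, probN_eq]
  congr! 3

lemma hk_nonneg {d n : ℕ} (z : V d) : 0 ≤ hk d n z := by
  classical
  rw [hk_eq]
  exact expN_nonneg fun s => by split_ifs <;> norm_num

lemma hk_le_one {d n : ℕ} (hd : 0 < d) (z : V d) : hk d n z ≤ 1 := by
  classical
  rw [hk_eq, ← expN_const (n := n) hd 1]
  refine expN_mono fun s => ?_
  simp only [expN_const hd]
  split_ifs <;> norm_num

lemma hk_zero {d : ℕ} (z : V d) : hk d 0 z = if z = 0 then 1 else 0 := by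
  classical
  rw [hk_eq, expN_zero, pos_zero]
  simp [eq_comm]

lemma hk_succ {d n : ℕ} (z : V d) :
    hk d (n + 1) z = (∑ e ∈ steps d, hk d n (z - e)) / ((2 * d : ℕ) : ℝ) := by
  classical
  rw [hk_eq, expN_succ]
  simp only [hk_eq, pos_cons, zero_add]
  congr 1
  refine Finset.sum_congr rfl fun e _ => ?_
  congr 1
  funext s
  rw [pos_eq_add e]
  simp [eq_sub_iff_add_eq, add_comm]

lemma hk_neg {d n : ℕ} (z : V d) : hk d n (-z) = hk d n z := by
  classical
  rw [hk_eq, hk_eq, expN_neg]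
  congr 1
  funext s
  rw [pos_neg]
  simp

lemma expN_hk_sub {d a n : ℕ} (z : V d) :
    expN d a (fun s => hk d n (z - pos 0 s a)) = hk d (n + a) z := by
  classical
  rw [add_comm n a, hk_eq, expN_join]
  simp only [hk_eq]
  congr 1
  funext s
  congr 1
  funext t
  rw [pos_join_add, pos_eq_add (pos 0 s a)]
  simp [eq_sub_iff_add_eq, add_comm]

lemma expN_hk_add {d a n : ℕ} (z : V d) :
    expN d a (fun s => hk d n (z + pos 0 s a)) = hk d (n + a) z := by
  rw [expN_neg]
  simp only [pos_neg, zero_sub, ← sub_eq_add_neg]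
  exact expN_hk_sub z

lemma sum_steps {d : ℕ} (F : V d → ℝ) :
    ∑ e ∈ steps d, F e = ∑ i : Fin d, (F (Pi.single i 1) + F (Pi.single i (-1))) := by
  unfold steps
  rw [Finset.sum_image (fun p _ q _ h => steps_injective d h), Fintype.sum_prod_type]
  refine Finset.sum_congr rfl fun i _ => ?_
  rw [Fintype.sum_bool]
  congr 2 <;> ext j <;> simp [Pi.single_apply]

section Torus

open Real

/-- The characteristic function of one step. -/
noncomputable def stepChar (d : ℕ) (θ : Fin d → ℝ) : ℝ := (∑ j, cos (θ j)) / d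

/-- Lebesgue measure on the torus `(0, 2π]^d`. -/
noncomputable def torusMeasure (d : ℕ) : Measure (Fin d → ℝ) :=
  Measure.pi fun _ => volume.restrict (Set.Ioc 0 (2 * π))

instance (d : ℕ) : IsFiniteMeasure (torusMeasure d) := by
  unfold torusMeasure; infer_instance

lemma abs_stepChar_le_one {d : ℕ} (θ : Fin d → ℝ) : |stepChar d θ| ≤ 1 := by
  unfold stepChar
  rw [abs_div, Nat.abs_cast]
  apply div_le_one_of_le₀ _ (Nat.cast_nonneg d)
  calc |∑ j, cos (θ j)| ≤ ∑ j, |cos (θ j)| := Finset.abs_sum_le_sum_abs _ _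
    _ ≤ ∑ _j : Fin d, (1 : ℝ) := Finset.sum_le_sum fun j _ => abs_cos_le_one _
    _ = d := by simp

lemma integrable_stepChar {d n : ℕ} (x : V d) :
    Integrable (fun θ => stepChar d θ ^ n * cos (∑ j, θ j * (x j : ℝ))) (torusMeasure d) := by
  refine Integrable.of_bound (C := 1) ?_ ?_
  · apply Continuous.aestronglyMeasurable
    unfold stepChar
    fun_prop
  · refine Filter.Eventually.of_forall fun θ => ?_
    rw [Real.norm_eq_abs, abs_mul, abs_pow]
    exact mul_le_one₀ (pow_le_one₀ (abs_nonneg _) (abs_stepChar_le_one θ)) (abs_nonneg _)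
      (abs_cos_le_one _)

lemma integral_exp_torus (k : ℤ) :
    ∫ θ in Set.Ioc 0 (2 * π), Complex.exp ((θ * k : ℝ) * Complex.I) =
      if k = 0 then ((2 * π : ℝ) : ℂ) else 0 := by
  rw [← intervalIntegral.integral_of_le (by positivity)]
  split_ifs with hk
  · simp [hk]
  · have hc : (k : ℂ) * Complex.I ≠ 0 := by simp [hk]
    have := integral_exp_mul_complex (a := 0) (b := 2 * π) hc
    simp only [Complex.ofReal_mul, Complex.ofReal_intCast]
    simp_rw [show ∀ θ : ℝ, (θ : ℂ) * k * Complex.I = k * Complex.I * θ from fun θ => by ring]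
    rw [this]
    have h2 : Complex.exp (k * Complex.I * ((2 * π : ℝ) : ℂ)) = 1 := by
      rw [Complex.exp_eq_one_iff]
      exact ⟨k, by push_cast; ring⟩
    rw [h2]
    simp

lemma integral_cos_torus {d : ℕ} (x : V d) :
    ∫ θ, cos (∑ j, θ j * (x j : ℝ)) ∂(torusMeasure d) =
      if x = 0 then (2 * π) ^ d else 0 := by
  have h : ∫ θ, Complex.exp (((∑ j, θ j * (x j : ℝ) : ℝ) : ℂ) * Complex.I) ∂(torusMeasure d) =
      if x = 0 then (((2 * π) ^ d : ℝ) : ℂ) else 0 := by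
    have e : ∀ θ : Fin d → ℝ, Complex.exp (((∑ j, θ j * (x j : ℝ) : ℝ) : ℂ) * Complex.I) =
        ∏ j, Complex.exp ((θ j * (x j) : ℝ) * Complex.I) := by
      intro θ
      rw [← Complex.exp_sum, ← Finset.sum_mul]
      push_cast
      rfl
    simp_rw [e]
    unfold torusMeasure
    rw [integral_fintype_prod_eq_prod (𝕜 := ℂ)
      (f := fun j (t : ℝ) => Complex.exp ((t * (x j) : ℝ) * Complex.I))]
    simp_rw [integral_exp_torus]
    split_ifs with hx
    · subst hx; simp
    · obtain ⟨j, hj⟩ := Function.ne_iff.1 hx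
      exact Finset.prod_eq_zero (Finset.mem_univ j) (if_neg hj)
  have hi : Integrable (fun θ : Fin d → ℝ =>
      Complex.exp (((∑ j, θ j * (x j : ℝ) : ℝ) : ℂ) * Complex.I)) (torusMeasure d) := by
    refine Integrable.of_bound (C := 1) (Continuous.aestronglyMeasurable (by fun_prop)) ?_
    exact Filter.Eventually.of_forall fun θ => by rw [Complex.norm_exp_ofReal_mul_I]
  have h2 := integral_re hi
  rw [h] at h2
  simp only [RCLike.re_to_complex, Complex.exp_ofReal_mul_I_re] at h2
  rw [h2]
  split_ifs <;> simp [-Complex.ofReal_pow, -Complex.ofReal_ofNat, -Complex.ofReal_mul]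

lemma integral_stepChar {d : ℕ} (hd : 0 < d) (n : ℕ) (x : V d) :
    ∫ θ, stepChar d θ ^ n * cos (∑ j, θ j * (x j : ℝ)) ∂(torusMeasure d) =
      (2 * π) ^ d * hk d n x := by
  induction n generalizing x with
  | zero =>
    simp only [pow_zero, one_mul, integral_cos_torus, hk_zero]
    split_ifs <;> simp
  | succ n ih =>
    rw [hk_succ, mul_div_assoc', Finset.mul_sum]
    simp_rw [← ih]
    rw [← integral_finsetSum _ (fun e _ => integrable_stepChar _), ← integral_div]
    congr 1
    funext θ
    rw [← Finset.mul_sum, sum_steps, pow_succ, mul_assoc, mul_div_assoc]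
    congr 1
    have hdR : (d : ℝ) ≠ 0 := by positivity
    have key : ∀ (i : Fin d) (c : ℤ), ∑ j, θ j * ((((x - Pi.single i c : V d) j : ℤ)) : ℝ) =
        ∑ j, θ j * (x j : ℝ) - c * θ i := by
      intro i c
      simp only [Pi.sub_apply, Int.cast_sub, mul_sub, Finset.sum_sub_distrib, Pi.single_apply]
      congr 1
      simp [mul_comm]
    simp only [key]
    have : ∀ i : Fin d, cos (∑ j, θ j * (x j : ℝ) - ((1 : ℤ) : ℝ) * θ i) +
        cos (∑ j, θ j * (x j : ℝ) - ((-1 : ℤ) : ℝ) * θ i) =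
        cos (θ i) * (2 * cos (∑ j, θ j * (x j : ℝ))) := by
      intro i
      push_cast
      rw [one_mul, neg_one_mul, sub_neg_eq_add, cos_sub, cos_add]
      ring
    simp only [this, ← Finset.sum_mul, stepChar]
    push_cast
    field_simp

lemma abs_stepChar_le {d : ℕ} (hd : 0 < d) (θ : Fin d → ℝ) :
    |stepChar d θ| ≤ ∏ j, exp (-(sin (θ j) ^ 2) / (2 * d)) := by
  have hdR : (0 : ℝ) < d := by positivity
  rw [← exp_sum, ← Finset.sum_div, Finset.sum_neg_distrib]
  apply abs_le_of_sq_le_sq _ (exp_pos _).le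
  rw [← exp_nat_mul]
  have h1 : stepChar d θ ^ 2 ≤ 1 - (∑ j, sin (θ j) ^ 2) / d := by
    have := sq_sum_le_card_mul_sum_sq (s := Finset.univ) (f := fun j => cos (θ j))
    simp only [Finset.card_univ, Fintype.card_fin] at this
    have h2 : ∑ j, cos (θ j) ^ 2 = d - ∑ j, sin (θ j) ^ 2 := by
      rw [eq_sub_iff_add_eq, ← Finset.sum_add_distrib]
      simp
    rw [h2] at this
    unfold stepChar
    rw [div_pow, div_le_iff₀ (by positivity)]
    refine this.trans (le_of_eq ?_)
    field_simp
  refine h1.trans ?_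
  have := add_one_le_exp (-(∑ j, sin (θ j) ^ 2) / d)
  refine le_trans (le_of_eq ?_) (this.trans (le_of_eq ?_))
  · ring
  · congr 1
    push_cast
    field_simp

lemma exp_sin_sq_le {b t : ℝ} (hb : 0 ≤ b) (h0 : 0 ≤ t) (h1 : t ≤ 2 * π) :
    exp (-b * sin t ^ 2) ≤ exp (-(4 * b / π ^ 2) * t ^ 2) +
      exp (-(4 * b / π ^ 2) * (t - π) ^ 2) + exp (-(4 * b / π ^ 2) * (t - 2 * π) ^ 2) := by
  have key : ∀ u : ℝ, |u| ≤ π / 2 →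
      exp (-b * sin u ^ 2) ≤ exp (-(4 * b / π ^ 2) * u ^ 2) := by
    intro u hu
    rw [exp_le_exp]
    have h := mul_abs_le_abs_sin hu
    have h2 : (2 / π * |u|) ^ 2 ≤ |sin u| ^ 2 := by
      have := pi_pos
      gcongr
    rw [sq_abs, mul_pow, sq_abs, div_pow] at h2
    have := mul_le_mul_of_nonneg_left h2 hb
    have e : (4 * b / π ^ 2) * u ^ 2 = b * (2 ^ 2 / π ^ 2 * u ^ 2) := by ring
    linarith
  have p1 := exp_pos (-(4 * b / π ^ 2) * t ^ 2)
  have p2 := exp_pos (-(4 * b / π ^ 2) * (t - π) ^ 2)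
  have p3 := exp_pos (-(4 * b / π ^ 2) * (t - 2 * π) ^ 2)
  rcases le_total t (π / 2) with h | h
  · have := key t (by rw [abs_of_nonneg h0]; exact h)
    linarith
  · rcases le_total t (3 * π / 2) with h' | h'
    · have := key (t - π) (by rw [abs_le]; constructor <;> linarith)
      rw [sin_sub_pi, neg_sq] at this
      linarith
    · have := key (t - 2 * π) (by rw [abs_le]; constructor <;> linarith)
      rw [sin_sub_two_pi] at this
      linarith

lemma integral_exp_sin_sq_le {b : ℝ} (hb : 0 < b) :
    ∫ t in Set.Ioc 0 (2 * π), exp (-b * sin t ^ 2) ≤ 3 * √(π / (4 * b / π ^ 2)) := by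
  have hb' : 0 < 4 * b / π ^ 2 := by positivity
  set β := 4 * b / π ^ 2 with hβ
  have i1 : Integrable (fun t : ℝ => exp (-β * t ^ 2)) := integrable_exp_neg_mul_sq hb'
  have i2 : Integrable (fun t : ℝ => exp (-β * (t - π) ^ 2)) := i1.comp_sub_right π
  have i3 : Integrable (fun t : ℝ => exp (-β * (t - 2 * π) ^ 2)) := i1.comp_sub_right (2 * π)
  have i12 : Integrable (fun t : ℝ => exp (-β * t ^ 2) + exp (-β * (t - π) ^ 2)) := i1.add i2
  have i123 : Integrable (fun t : ℝ => exp (-β * t ^ 2) + exp (-β * (t - π) ^ 2) +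
      exp (-β * (t - 2 * π) ^ 2)) := i12.add i3
  calc ∫ t in Set.Ioc 0 (2 * π), exp (-b * sin t ^ 2)
      ≤ ∫ t in Set.Ioc 0 (2 * π), (exp (-β * t ^ 2) + exp (-β * (t - π) ^ 2) +
          exp (-β * (t - 2 * π) ^ 2)) := by
        apply setIntegral_mono_on _ i123.integrableOn measurableSet_Ioc
        · intro t ht
          exact exp_sin_sq_le hb.le ht.1.le ht.2
        · exact (Continuous.integrableOn_Icc (by fun_prop)).mono_set Set.Ioc_subset_Icc_self
    _ ≤ ∫ t, (exp (-β * t ^ 2) + exp (-β * (t - π) ^ 2) + exp (-β * (t - 2 * π) ^ 2)) :=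
        setIntegral_le_integral i123 (Filter.Eventually.of_forall fun t => by positivity)
    _ = 3 * √(π / β) := by
        rw [integral_add i12 i3, integral_add i1 i2,
          integral_sub_right_eq_self (fun t => exp (-β * t ^ 2)) π,
          integral_sub_right_eq_self (fun t => exp (-β * t ^ 2)) (2 * π), integral_gaussian]
        ring

/-- Uniform on-diagonal upper bound for the heat kernel. -/
lemma exists_hk_le {d : ℕ} (hd : 0 < d) :
    ∃ C : ℝ, 0 < C ∧ ∀ (n : ℕ) (z : V d), hk d n z ≤ C * ((n : ℝ) + 1) ^ (-(d : ℝ) / 2) := by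
  have hdR : (0 : ℝ) < d := by positivity
  set c : ℝ := 3 * √(π ^ 3 * d) with hc
  have hc0 : 0 < c := by positivity
  have main : ∀ (n : ℕ) (z : V d), 0 < n →
      hk d n z ≤ (c / (2 * π)) ^ d * (n : ℝ) ^ (-(d : ℝ) / 2) := by
    intro n z hn
    have hnR : (0 : ℝ) < n := by positivity
    have h1 : (2 * π) ^ d * hk d n z ≤ (c * √(1 / n)) ^ d := by
      rw [← integral_stepChar hd]
      calc ∫ θ, stepChar d θ ^ n * cos (∑ j, θ j * (z j : ℝ)) ∂(torusMeasure d)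
          ≤ ∫ θ, ∏ j, exp (-(n / (2 * d) : ℝ) * sin (θ j) ^ 2) ∂(torusMeasure d) := by
            apply integral_mono (integrable_stepChar z)
            · refine Integrable.of_bound (C := 1)
                (Continuous.aestronglyMeasurable (by fun_prop)) ?_
              refine Filter.Eventually.of_forall fun θ => ?_
              rw [Real.norm_eq_abs, Finset.abs_prod]
              apply Finset.prod_le_one (fun j _ => abs_nonneg _)
              intro j _
              rw [abs_exp, exp_le_one_iff, neg_mul]
              have : 0 ≤ (n / (2 * d) : ℝ) * sin (θ j) ^ 2 := by positivity
              linarith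
            · intro θ
              calc stepChar d θ ^ n * cos (∑ j, θ j * (z j : ℝ))
                  ≤ |stepChar d θ ^ n * cos (∑ j, θ j * (z j : ℝ))| := le_abs_self _
                _ ≤ |stepChar d θ| ^ n * 1 := by
                    rw [abs_mul, abs_pow]
                    gcongr
                    exact abs_cos_le_one _
                _ ≤ (∏ j, exp (-(sin (θ j) ^ 2) / (2 * d))) ^ n := by
                    rw [mul_one]
                    gcongr
                    exact abs_stepChar_le hd θ
                _ = ∏ j, exp (-(n / (2 * d) : ℝ) * sin (θ j) ^ 2) := by
                    rw [← Finset.prod_pow]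
                    refine Finset.prod_congr rfl fun j _ => ?_
                    rw [← exp_nat_mul]
                    congr 1
                    ring
        _ = ∏ _j : Fin d, ∫ t in Set.Ioc 0 (2 * π), exp (-(n / (2 * d) : ℝ) * sin t ^ 2) := by
            unfold torusMeasure
            exact integral_fintype_prod_eq_prod (𝕜 := ℝ)
              (f := fun (_ : Fin d) (t : ℝ) => exp (-(n / (2 * d) : ℝ) * sin t ^ 2))
        _ ≤ ∏ _j : Fin d, c * √(1 / n) := by
            apply Finset.prod_le_prod
            · intro j _
              exact integral_nonneg fun t => (exp_pos _).le
            · intro j _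
              refine (integral_exp_sin_sq_le (b := n / (2 * d)) (by positivity)).trans ?_
              rw [hc, mul_assoc, ← Real.sqrt_mul (by positivity)]
              gcongr
              have : π / (4 * (n / (2 * d)) / π ^ 2) = π ^ 3 * d * (1 / n) / 2 := by
                field_simp
                ring
              rw [this]
              have : 0 ≤ π ^ 3 * d * (1 / n) := by positivity
              linarith
        _ = _ := by simp
    have h2 : (√(1 / n)) ^ d = (n : ℝ) ^ (-(d : ℝ) / 2) := by
      rw [one_div, Real.sqrt_eq_rpow, Real.inv_rpow hnR.le, ← Real.rpow_neg hnR.le,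
        ← Real.rpow_natCast, ← Real.rpow_mul hnR.le]
      congr 1
      ring
    rw [mul_pow c, h2] at h1
    rw [div_pow, div_mul_eq_mul_div, le_div_iff₀ (by positivity)]
    linarith
  refine ⟨max 1 ((c / (2 * π)) ^ d * 2 ^ ((d : ℝ) / 2)), by positivity, fun n z => ?_⟩
  rcases Nat.eq_zero_or_pos n with rfl | hn
  · simp only [CharP.cast_eq_zero, zero_add, one_rpow, mul_one]
    exact (hk_le_one hd z).trans (le_max_left _ _)
  · have hnR : (0 : ℝ) < n := by positivity
    have hn1 : (1 : ℝ) ≤ n := by exact_mod_cast hn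
    refine (main n z hn).trans ?_
    calc (c / (2 * π)) ^ d * (n : ℝ) ^ (-(d : ℝ) / 2)
        ≤ (c / (2 * π)) ^ d * (2 ^ ((d : ℝ) / 2) * ((n : ℝ) + 1) ^ (-(d : ℝ) / 2)) := by
          gcongr
          rw [neg_div, Real.rpow_neg hnR.le, Real.rpow_neg (by positivity), ← div_eq_mul_inv,
            le_div_iff₀ (by positivity), inv_mul_eq_div, div_le_iff₀ (by positivity),
            ← Real.mul_rpow (by norm_num) hnR.le]
          gcongr
          linarith
      _ ≤ _ := by
          rw [← mul_assoc]
          gcongr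
          exact le_max_right _ _

end Torus

/-! ### Tails of the Green function -/

/-- The tail `Σ_{n ≥ b} P_0(S_n = z)` of the Green function. -/
noncomputable def tailG (d b : ℕ) (z : V d) : ℝ := ∑' n : ℕ, hk d (n + b) z

lemma G_eq_tailG {d : ℕ} (z : V d) : G d z = tailG d 0 z := rfl

lemma rpow_telescope {γ x : ℝ} (hγ : 0 < γ) (hx : 1 ≤ x) :
    x ^ (-(γ + 1)) ≤ 2 ^ (γ + 1) / γ * (x ^ (-γ) - (x + 1) ^ (-γ)) := by
  have hx0 : 0 < x := by linarith
  have hx1 : 0 < x + 1 := by linarith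
  have h1 : 1 + γ / (x + 1) ≤ (x / (x + 1)) ^ (-γ) := by
    rw [Real.rpow_def_of_pos (by positivity)]
    have hl := Real.log_le_sub_one_of_pos (show 0 < x / (x + 1) by positivity)
    have e : x / (x + 1) - 1 = -(1 / (x + 1)) := by field_simp; ring
    rw [e] at hl
    have h2 : γ / (x + 1) ≤ Real.log (x / (x + 1)) * -γ := by
      have := mul_le_mul_of_nonneg_right hl hγ.le
      have e2 : γ / (x + 1) = 1 / (x + 1) * γ := by ring
      rw [e2]; linarith
    have := Real.add_one_le_exp (Real.log (x / (x + 1)) * -γ)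
    linarith
  rw [Real.div_rpow hx0.le hx1.le, le_div_iff₀ (by positivity)] at h1
  have h3 : (x + 1) ^ (-(γ + 1)) = (x + 1) ^ (-γ) / (x + 1) := by
    rw [neg_add, ← sub_eq_add_neg, Real.rpow_sub hx1, Real.rpow_one]
  have h4 : γ * (x + 1) ^ (-(γ + 1)) ≤ x ^ (-γ) - (x + 1) ^ (-γ) := by
    rw [h3]
    have : (1 + γ / (x + 1)) * (x + 1) ^ (-γ) =
      (x + 1) ^ (-γ) + γ * ((x + 1) ^ (-γ) / (x + 1)) := by ring
    linarith
  have h5 : x ^ (-(γ + 1)) ≤ 2 ^ (γ + 1) * (x + 1) ^ (-(γ + 1)) := by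
    rw [Real.rpow_neg hx0.le, Real.rpow_neg hx1.le, ← div_eq_mul_inv, inv_eq_one_div,
      div_le_div_iff₀ (by positivity) (by positivity), one_mul, ← Real.mul_rpow (by norm_num) hx0.le]
    gcongr
    linarith
  calc x ^ (-(γ + 1)) ≤ 2 ^ (γ + 1) * (x + 1) ^ (-(γ + 1)) := h5
    _ = 2 ^ (γ + 1) / γ * (γ * (x + 1) ^ (-(γ + 1))) := by field_simp
    _ ≤ _ := by gcongr

lemma sum_rpow_le {γ : ℝ} (hγ : 0 < γ) (b N : ℕ) :
    ∑ n ∈ range N, (((n + b : ℕ) : ℝ) + 1) ^ (-(γ + 1)) ≤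
      2 ^ (γ + 1) / γ * ((b : ℝ) + 1) ^ (-γ) := by
  have h : ∑ n ∈ range N, (((n + b : ℕ) : ℝ) + 1) ^ (-(γ + 1)) ≤
      2 ^ (γ + 1) / γ * (((b : ℝ) + 1) ^ (-γ) - (((N + b : ℕ) : ℝ) + 1) ^ (-γ)) := by
    induction N with
    | zero => simp
    | succ N ih =>
      rw [Finset.sum_range_succ]
      have := rpow_telescope hγ (x := ((N + b : ℕ) : ℝ) + 1)
        (by have := Nat.cast_nonneg (α := ℝ) (N + b); linarith)
      have e : (((N + 1 + b : ℕ) : ℝ) + 1) = ((N + b : ℕ) : ℝ) + 1 + 1 := by push_cast; ring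
      rw [e]
      have := add_le_add ih this
      refine this.trans (le_of_eq ?_)
      ring
  refine h.trans ?_
  gcongr
  have : 0 ≤ (((N + b : ℕ) : ℝ) + 1) ^ (-γ) := by positivity
  linarith

lemma exists_hk_le_of_le {d : ℕ} (hd : 0 < d) {γ : ℝ} (h : γ + 1 ≤ (d : ℝ) / 2) :
    ∃ C : ℝ, 0 < C ∧ ∀ (n : ℕ) (z : V d), hk d n z ≤ C * ((n : ℝ) + 1) ^ (-(γ + 1)) := by
  obtain ⟨C, hC, hb⟩ := exists_hk_le hd
  refine ⟨C, hC, fun n z => (hb n z).trans ?_⟩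
  gcongr
  · have := Nat.cast_nonneg (α := ℝ) n; linarith
  · linarith

lemma exists_sum_hk_le {d : ℕ} (hd : 0 < d) {γ : ℝ} (hγ : 0 < γ) (h : γ + 1 ≤ (d : ℝ) / 2) :
    ∃ C : ℝ, 0 < C ∧ ∀ (b N : ℕ) (z : V d),
      ∑ n ∈ range N, hk d (n + b) z ≤ C * ((b : ℝ) + 1) ^ (-γ) := by
  obtain ⟨C, hC, hb⟩ := exists_hk_le_of_le hd h
  refine ⟨C * (2 ^ (γ + 1) / γ), by positivity, fun b N z => ?_⟩
  calc ∑ n ∈ range N, hk d (n + b) z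
      ≤ ∑ n ∈ range N, C * (((n + b : ℕ) : ℝ) + 1) ^ (-(γ + 1)) :=
        Finset.sum_le_sum fun n _ => hb _ _
    _ ≤ _ := by
        rw [← Finset.mul_sum, mul_assoc]
        gcongr
        exact sum_rpow_le hγ b N

lemma summable_hk {d : ℕ} (hd : 5 ≤ d) (b : ℕ) (z : V d) :
    Summable fun n => hk d (n + b) z := by
  have h5 : (5 : ℝ) ≤ d := by exact_mod_cast hd
  obtain ⟨C, hC, h⟩ := exists_sum_hk_le (d := d) (γ := 3 / 2) (by omega) (by norm_num)
    (by linarith)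
  exact summable_of_sum_range_le (fun n => hk_nonneg _) (fun N => h b N z)

lemma hasSum_tailG {d : ℕ} (hd : 5 ≤ d) (b : ℕ) (z : V d) :
    HasSum (fun n => hk d (n + b) z) (tailG d b z) := (summable_hk hd b z).hasSum

lemma exists_tailG_le {d : ℕ} (hd : 0 < d) {γ : ℝ} (hγ : 0 < γ) (h : γ + 1 ≤ (d : ℝ) / 2) :
    ∃ C : ℝ, 0 < C ∧ ∀ (b : ℕ) (z : V d), tailG d b z ≤ C * ((b : ℝ) + 1) ^ (-γ) := by
  obtain ⟨C, hC, hb⟩ := exists_sum_hk_le hd hγ h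
  exact ⟨C, hC, fun b z => Real.tsum_le_of_sum_range_le (fun n => hk_nonneg _) (fun N => hb b N z)⟩

lemma tailG_nonneg {d b : ℕ} (z : V d) : 0 ≤ tailG d b z := tsum_nonneg fun _ => hk_nonneg _

lemma tailG_neg {d b : ℕ} (z : V d) : tailG d b (-z) = tailG d b z := by
  simp [tailG, hk_neg]

lemma tailG_sub_comm {d b : ℕ} (x y : V d) : tailG d b (x - y) = tailG d b (y - x) := by
  rw [← neg_sub, tailG_neg]

lemma tailG_succ {d : ℕ} (hd : 5 ≤ d) (b : ℕ) (z : V d) :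
    tailG d b z = hk d b z + tailG d (b + 1) z := by
  have := (summable_hk hd b z).tsum_eq_zero_add
  simp only [tailG]
  rw [this]
  congr 1
  · simp
  · exact tsum_congr fun n => by rw [add_right_comm, add_assoc]

lemma tailG_antitone {d : ℕ} (hd : 5 ≤ d) (z : V d) : Antitone fun b => tailG d b z :=
  antitone_nat_of_succ_le fun b => by
    rw [tailG_succ hd b]
    have := hk_nonneg (n := b) z
    linarith

lemma hasSum_expN {d n : ℕ} {ι : Type*} {F : ι → (ℕ → V d) → ℝ} {f : (ℕ → V d) → ℝ}
    (h : ∀ s, HasSum (fun i => F i s) (f s)) :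
    HasSum (fun i => expN d n (F i)) (expN d n f) := by
  simp only [expN_eq]
  exact (hasSum_sum fun s _ => h (extSteps s)).div_const _

lemma expN_tailG_add {d : ℕ} (hd : 5 ≤ d) (a b : ℕ) (z : V d) :
    expN d a (fun s => tailG d b (z + pos 0 s a)) = tailG d (b + a) z := by
  have h := hasSum_expN (n := a) (F := fun n s => hk d (n + b) (z + pos 0 s a))
    (fun s => hasSum_tailG hd b _)
  simp only [expN_hk_add, add_assoc] at h
  exact h.unique (hasSum_tailG hd (b + a) z)

lemma expN_tailG_sub {d : ℕ} (hd : 5 ≤ d) (a b : ℕ) (z : V d) :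
    expN d a (fun s => tailG d b (z - pos 0 s a)) = tailG d (b + a) z := by
  rw [← expN_tailG_add hd, expN_neg]
  simp only [pos_neg, zero_sub, sub_neg_eq_add]

/-- The Green function is harmonic away from the origin. -/
lemma tailG_succ_eq {d : ℕ} (hd : 5 ≤ d) (b : ℕ) (z : V d) :
    tailG d (b + 1) z = (∑ e ∈ steps d, tailG d b (z + e)) / ((2 * d : ℕ) : ℝ) := by
  rw [← expN_tailG_add hd, expN_succ]
  congr 1
  refine Finset.sum_congr rfl fun e _ => ?_
  rw [expN_zero, pos_cons, pos_zero, zero_add]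

lemma GconvGT_eq {d : ℕ} (hd : 5 ≤ d) (T : ℕ) (x : V d) :
    GconvGT d T x = ∑ t ∈ range (T + 1), tailG d t x := by
  classical
  have h : ∀ t, HasSum (fun y => G d (x - y) * hk d t y) (tailG d t x) := by
    intro t
    have := hasSum_expN (n := t)
      (F := fun (y : V d) s => G d (x - y) * (if pos 0 s t = y then 1 else 0))
      (f := fun s => G d (x - pos 0 s t)) (fun s => by
        have := hasSum_ite_eq (pos 0 s t) (G d (x - pos 0 s t))
        convert this using 2 with y
        by_cases hy : y = pos 0 s t
        · simp [hy]
        · simp [hy, Ne.symm hy])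
    simp only [expN_const_mul, ← hk_eq] at this
    simp only [G_eq_tailG] at this ⊢
    rwa [expN_tailG_sub hd, zero_add] at this
  unfold GconvGT GT
  simp only [Finset.mul_sum]
  exact (hasSum_sum fun t _ => h t).tsum_eq

lemma GconvGT_nonneg {d : ℕ} (hd : 5 ≤ d) (T : ℕ) (x : V d) : 0 ≤ GconvGT d T x := by
  rw [GconvGT_eq hd]
  exact Finset.sum_nonneg fun t _ => tailG_nonneg x

lemma GconvGT_neg {d : ℕ} (hd : 5 ≤ d) (T : ℕ) (x : V d) : GconvGT d T (-x) = GconvGT d T x := by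
  simp [GconvGT_eq hd, tailG_neg]

/-! ### Escape probabilities, equilibrium potentials and capacity -/

/-- Probability that the walk from `x` avoids `A` at the times `1, …, m`. -/
noncomputable def noHit (d m : ℕ) (A : Set (V d)) (x : V d) : ℝ :=
  probN d m (fun s => ∀ k, 1 ≤ k → k ≤ m → pos x s k ∉ A)

lemma noHit_nonneg {d m : ℕ} (A : Set (V d)) (x : V d) : 0 ≤ noHit d m A x := by
  classical
  rw [noHit, probN_eq]
  exact expN_nonneg fun s => by split_ifs <;> norm_num

lemma noHit_zero {d : ℕ} (A : Set (V d)) (x : V d) : noHit d 0 A x = 1 := by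
  classical
  rw [noHit, probN_eq, expN_zero, if_pos]
  intro k h1 h2
  omega

open Classical in
lemma noHit_succ {d m : ℕ} (A : Set (V d)) (x : V d) :
    noHit d (m + 1) A x =
      (∑ e ∈ steps d, if x + e ∈ A then 0 else noHit d m A (x + e)) / ((2 * d : ℕ) : ℝ) := by
  rw [noHit, probN_eq, expN_succ]
  congr 1
  refine Finset.sum_congr rfl fun e _ => ?_
  have key : ∀ s : ℕ → V d, (∀ k, 1 ≤ k → k ≤ m + 1 → pos x (consStep e s) k ∉ A) ↔
      (x + e ∉ A ∧ ∀ k, 1 ≤ k → k ≤ m → pos (x + e) s k ∉ A) := by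
    intro s
    constructor
    · intro h
      refine ⟨?_, fun k h1 h2 => ?_⟩
      · have := h 1 le_rfl (by omega)
        rwa [pos_cons, pos_zero] at this
      · have := h (k + 1) (by omega) (by omega)
        rwa [pos_cons] at this
    · rintro ⟨h0, h⟩ k h1 h2
      obtain ⟨k, rfl⟩ := Nat.exists_eq_add_of_le' h1
      rw [pos_cons]
      rcases Nat.eq_zero_or_pos k with rfl | hk
      · rwa [pos_zero]
      · exact h k hk (by omega)
  simp only [key]
  split_ifs with hA
  · simp [hA, expN_eq]
  · simp only [hA, not_false_eq_true, true_and]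
    rw [noHit, probN_eq]
    congr! 3

lemma noHit_anti_set {d m : ℕ} {A B : Set (V d)} (h : A ⊆ B) (x : V d) :
    noHit d m B x ≤ noHit d m A x := by
  classical
  simp only [noHit, probN_eq]
  refine expN_mono fun s => ?_
  split_ifs with h1 h2
  · exact le_rfl
  · exact absurd (fun k a b hk => h1 k a b (h hk)) h2
  · norm_num
  · exact le_rfl

lemma sum_steps_const {d : ℕ} (hd : 0 < d) (c : ℝ) :
    (∑ _e ∈ steps d, c) / ((2 * d : ℕ) : ℝ) = c := by
  have : ((2 * d : ℕ) : ℝ) ≠ 0 := by positivity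
  rw [Finset.sum_const, card_steps, nsmul_eq_mul]
  field_simp

lemma noHit_succ_le {d : ℕ} (hd : 0 < d) (m : ℕ) (A : Set (V d)) (x : V d) :
    noHit d (m + 1) A x ≤ noHit d m A x := by
  classical
  induction m generalizing x with
  | zero =>
    rw [noHit_succ]
    simp only [noHit_zero]
    refine le_trans ?_ (sum_steps_const hd 1).le
    gcongr
    split_ifs <;> norm_num
  | succ m ih =>
    rw [noHit_succ, noHit_succ]
    gcongr
    split_ifs
    · exact le_rfl
    · exact ih _

lemma noHit_antitone {d : ℕ} (hd : 0 < d) (A : Set (V d)) (x : V d) :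
    Antitone fun m => noHit d m A x := antitone_nat_of_succ_le fun m => noHit_succ_le hd m A x

lemma noHit_le_one {d : ℕ} (hd : 0 < d) (m : ℕ) (A : Set (V d)) (x : V d) : noHit d m A x ≤ 1 :=
  (noHit_antitone hd A x (Nat.zero_le m)).trans (noHit_zero A x).le

lemma esc_eq {d : ℕ} (A : Set (V d)) (x : V d) : esc d A x = ⨅ m, noHit d m A x := rfl

lemma bddBelow_noHit {d : ℕ} (A : Set (V d)) (x : V d) :
    BddBelow (Set.range fun m => noHit d m A x) :=
  ⟨0, by rintro _ ⟨m, rfl⟩; exact noHit_nonneg A x⟩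

lemma tendsto_noHit {d : ℕ} (hd : 0 < d) (A : Set (V d)) (x : V d) :
    Tendsto (fun m => noHit d m A x) atTop (nhds (esc d A x)) :=
  tendsto_atTop_ciInf (noHit_antitone hd A x) (bddBelow_noHit A x)

lemma esc_nonneg {d : ℕ} (A : Set (V d)) (x : V d) : 0 ≤ esc d A x :=
  Real.iInf_nonneg fun _ => noHit_nonneg A x

lemma esc_le_one {d : ℕ} (A : Set (V d)) (x : V d) : esc d A x ≤ 1 :=
  (ciInf_le (bddBelow_noHit A x) 0).trans (noHit_zero A x).le

lemma esc_anti {d : ℕ} {A B : Set (V d)} (h : A ⊆ B) (x : V d) : esc d B x ≤ esc d A x :=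
  ciInf_mono (bddBelow_noHit B x) fun _ => noHit_anti_set h x

lemma noHit_translate {d m : ℕ} {A B : Set (V d)} {v : V d} (h : ∀ y, v + y ∈ B ↔ y ∈ A)
    (x : V d) : noHit d m B (v + x) = noHit d m A x := by
  classical
  simp only [noHit]
  congr 1
  funext s
  refine propext (forall_congr' fun k => forall_congr' fun _ => forall_congr' fun _ => ?_)
  rw [pos_eq_add, add_assoc, h, ← pos_eq_add]

open Classical in
/-- Probability that the walk from `z` hits `A` before or at time `N`. -/
noncomputable def hitBy (d N : ℕ) (A : Set (V d)) (z : V d) : ℝ :=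
  1 - if z ∈ A then 0 else noHit d N A z

lemma hitBy_le_one {d N : ℕ} (A : Set (V d)) (z : V d) : hitBy d N A z ≤ 1 := by
  have := noHit_nonneg (m := N) A z
  unfold hitBy
  split_ifs <;> linarith

lemma hitBy_of_mem {d N : ℕ} {A : Set (V d)} {z : V d} (h : z ∈ A) : hitBy d N A z = 1 := by
  simp [hitBy, h]

lemma hitBy_nonneg {d : ℕ} (hd : 0 < d) (N : ℕ) (A : Set (V d)) (z : V d) :
    0 ≤ hitBy d N A z := by
  have := noHit_le_one hd N A z
  unfold hitBy
  split_ifs <;> linarith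

lemma sum_hitBy {d : ℕ} (hd : 0 < d) (N : ℕ) (A : Set (V d)) (z : V d) :
    (∑ e ∈ steps d, hitBy d N A (z + e)) / ((2 * d : ℕ) : ℝ) = 1 - noHit d (N + 1) A z := by
  classical
  simp only [hitBy]
  rw [Finset.sum_sub_distrib, sub_div, sum_steps_const hd, noHit_succ]

lemma hk_succ_add {d n : ℕ} (z : V d) :
    hk d (n + 1) z = (∑ e ∈ steps d, hk d n (z + e)) / ((2 * d : ℕ) : ℝ) := by
  rw [← hk_neg, hk_succ]
  congr 1
  refine Finset.sum_congr rfl fun e _ => ?_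
  rw [← hk_neg (z + e), neg_add, sub_eq_add_neg]

/-- Last-exit decomposition over a finite time horizon. -/
lemma sum_hk_noHit {d : ℕ} (hd : 0 < d) (A : Finset (V d)) (N : ℕ) (z : V d) :
    ∑ n ∈ range (N + 1), ∑ x ∈ A, hk d n (z - x) * noHit d (N - n) (↑A) x = hitBy d N (↑A) z := by
  classical
  have h0 : ∀ (M : ℕ) (z : V d), ∑ x ∈ A, hk d 0 (z - x) * noHit d M (↑A) x =
      if z ∈ A then noHit d M (↑A) z else 0 := by
    intro M z
    simp only [hk_zero, sub_eq_zero, ite_mul, one_mul, zero_mul]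
    rw [Finset.sum_ite_eq]
  induction N generalizing z with
  | zero =>
    simp only [zero_add, Finset.sum_range_one, h0, hitBy, noHit_zero, Finset.mem_coe]
    split_ifs <;> simp [noHit_zero]
  | succ N ih =>
    rw [Finset.sum_range_succ', Nat.sub_zero, h0]
    simp only [hk_succ_add, Nat.add_sub_add_right, div_mul_eq_mul_div, Finset.sum_mul,
      ← Finset.sum_div]
    have : ∑ n ∈ range (N + 1), ∑ x ∈ A, ∑ e ∈ steps d,
        hk d n (z - x + e) * noHit d (N - n) (↑A) x = ∑ e ∈ steps d, hitBy d N (↑A) (z + e) := by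
      simp only [← ih]
      rw [Finset.sum_comm]
      conv_rhs => rw [Finset.sum_comm]
      rw [Finset.sum_comm]
      refine Finset.sum_congr rfl fun n _ => ?_
      rw [Finset.sum_comm]
      refine Finset.sum_congr rfl fun e _ => Finset.sum_congr rfl fun x _ => ?_
      rw [sub_add_eq_add_sub]
    rw [this, sum_hitBy hd, hitBy]
    simp only [Finset.mem_coe]
    split_ifs <;> ring

/-- The equilibrium potential `Σ_{x ∈ A} G(z - x) P_x(H_A^+ = ∞)` of a finite set. -/
noncomputable def pot {d : ℕ} (A : Finset (V d)) (z : V d) : ℝ :=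
  ∑ x ∈ A, esc d (↑A) x * G d (z - x)

lemma tendsto_hitBy {d : ℕ} (hd : 5 ≤ d) (A : Finset (V d)) (z : V d) :
    Tendsto (fun N => hitBy d N (↑A) z) atTop (nhds (pot A z)) := by
  have hd0 : 0 < d := by omega
  simp only [← sum_hk_noHit hd0]
  have key : ∀ x, Tendsto (fun N => ∑ n ∈ range (N + 1), hk d n (z - x) * noHit d (N - n) (↑A) x)
      atTop (nhds (esc d (↑A) x * G d (z - x))) := by
    intro x
    have h := tendsto_tsum_of_dominated_convergence (𝓕 := atTop)
      (f := fun N n => if n ∈ range (N + 1) then hk d n (z - x) * noHit d (N - n) (↑A) x else 0)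
      (g := fun n => hk d n (z - x) * esc d (↑A) x) (bound := fun n => hk d n (z - x))
      (by simpa using summable_hk hd 0 (z - x))
      (fun n => by
        have h1 : Tendsto (fun N => hk d n (z - x) * noHit d (N - n) (↑A) x) atTop
            (nhds (hk d n (z - x) * esc d (↑A) x)) :=
          ((tendsto_noHit hd0 (↑A) x).comp (tendsto_sub_atTop_nat n)).const_mul _
        refine h1.congr' ?_
        filter_upwards [eventually_ge_atTop n] with N hN
        rw [if_pos (Finset.mem_range.2 (by omega))])
      (Filter.Eventually.of_forall fun N n => by
        split_ifs
        · rw [Real.norm_eq_abs, abs_of_nonneg (mul_nonneg (hk_nonneg _) (noHit_nonneg _ _))]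
          exact mul_le_of_le_one_right (hk_nonneg _) (noHit_le_one hd0 _ _ _)
        · simpa using hk_nonneg _)
    rw [tsum_mul_right, mul_comm] at h
    refine (h.congr fun N => ?_)
    rw [tsum_eq_sum (s := range (N + 1)) (fun n hn => if_neg hn)]
    exact Finset.sum_congr rfl fun n hn => if_pos hn
  simp_rw [Finset.sum_comm (s := range _)]
  exact tendsto_finsetSum _ fun x _ => key x

lemma pot_of_mem {d : ℕ} (hd : 5 ≤ d) {A : Finset (V d)} {z : V d} (h : z ∈ A) : pot A z = 1 :=
  tendsto_nhds_unique (tendsto_hitBy hd A z)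
    (by simp only [hitBy_of_mem (Finset.mem_coe.2 h)]; exact tendsto_const_nhds)

lemma pot_le_one {d : ℕ} (hd : 5 ≤ d) (A : Finset (V d)) (z : V d) : pot A z ≤ 1 :=
  le_of_tendsto' (tendsto_hitBy hd A z) fun _ => hitBy_le_one _ _

lemma G_nonneg {d : ℕ} (z : V d) : 0 ≤ G d z := tailG_nonneg (b := 0) z

lemma G_sub_comm {d : ℕ} (x y : V d) : G d (x - y) = G d (y - x) := tailG_sub_comm (b := 0) x y

lemma pot_nonneg {d : ℕ} (A : Finset (V d)) (z : V d) : 0 ≤ pot A z :=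
  Finset.sum_nonneg fun _ _ => mul_nonneg (esc_nonneg _ _) (G_nonneg _)

lemma cap_eq_sum_pot {d : ℕ} (hd : 5 ≤ d) {A K : Finset (V d)} (h : A ⊆ K) :
    cap A = ∑ z ∈ K, esc d (↑K) z * pot A z := by
  calc cap A = ∑ x ∈ A, esc d (↑A) x * pot K x :=
        Finset.sum_congr rfl fun x hx => by rw [pot_of_mem hd (h hx), mul_one]
    _ = _ := by
        simp only [pot, Finset.mul_sum]
        rw [Finset.sum_comm]
        refine Finset.sum_congr rfl fun z _ => Finset.sum_congr rfl fun x _ => ?_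
        rw [G_sub_comm]
        ring

lemma cap_nonneg {d : ℕ} (A : Finset (V d)) : 0 ≤ cap A :=
  Finset.sum_nonneg fun _ _ => esc_nonneg _ _

lemma cap_le_card {d : ℕ} (A : Finset (V d)) : cap A ≤ A.card := by
  refine (Finset.sum_le_sum fun x _ => esc_le_one (↑A) x).trans ?_
  simp

lemma cap_mono {d : ℕ} (hd : 5 ≤ d) {A K : Finset (V d)} (h : A ⊆ K) : cap A ≤ cap K := by
  rw [cap_eq_sum_pot hd h]
  exact Finset.sum_le_sum fun z _ => mul_le_of_le_one_right (esc_nonneg _ _) (pot_le_one hd _ _)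

lemma cap_translate {d : ℕ} (v : V d) (A : Finset (V d)) :
    cap (A.image fun y => v + y) = cap A := by
  unfold cap
  rw [Finset.sum_image (fun _ _ _ _ h => add_left_cancel h)]
  refine Finset.sum_congr rfl fun x _ => ?_
  rw [esc_eq, esc_eq]
  refine iInf_congr fun m => noHit_translate (fun y => ?_) x
  simp

lemma chiC_nonneg {d : ℕ} (A B : Finset (V d)) : 0 ≤ chiC A B := by
  have hA : ∑ z ∈ A, esc d (↑(A ∪ B) : Set (V d)) z ≤ cap A :=
    Finset.sum_le_sum fun z _ => esc_anti (by simp) z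
  have hB : ∑ z ∈ B, esc d (↑(A ∪ B) : Set (V d)) z ≤ cap B :=
    Finset.sum_le_sum fun z _ => esc_anti (by simp) z
  have h : cap (A ∪ B) ≤ ∑ z ∈ A, esc d (↑(A ∪ B) : Set (V d)) z +
      ∑ z ∈ B, esc d (↑(A ∪ B) : Set (V d)) z := by
    rw [← Finset.sum_union_inter]
    exact le_add_of_nonneg_right (Finset.sum_nonneg fun _ _ => esc_nonneg _ _)
  unfold chiC
  linarith

lemma chiC_le_cap {d : ℕ} (hd : 5 ≤ d) (A B : Finset (V d)) : chiC A B ≤ cap B := by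
  have := cap_mono hd (Finset.subset_union_left (s₁ := A) (s₂ := B))
  unfold chiC
  linarith

lemma chiC_le {d : ℕ} (hd : 5 ≤ d) (A B : Finset (V d)) :
    chiC A B ≤ 2 * ∑ x ∈ A, esc d (↑A) x * ∑ y ∈ B, esc d (↑B) y * G d (x - y) := by
  classical
  set K := A ∪ B with hK
  have h1 : chiC A B = ∑ z ∈ K, esc d (↑K) z * (pot A z + pot B z - 1) := by
    have e : cap K = ∑ z ∈ K, esc d (↑K) z := rfl
    rw [chiC, cap_eq_sum_pot hd (Finset.subset_union_left : A ⊆ K),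
      cap_eq_sum_pot hd (Finset.subset_union_right : B ⊆ K), ← hK, e,
      ← Finset.sum_add_distrib, ← Finset.sum_sub_distrib]
    exact Finset.sum_congr rfl fun z _ => by ring
  have h2 : ∀ z ∈ K, esc d (↑K) z * (pot A z + pot B z - 1) ≤
      (if z ∈ A then esc d (↑A) z * pot B z else 0) +
        (if z ∈ B then esc d (↑B) z * pot A z else 0) := by
    intro z hz
    have hB0 := pot_nonneg B z
    have hA0 := pot_nonneg A z
    have e0 := esc_nonneg (↑K) z
    have nB : 0 ≤ (if z ∈ B then esc d (↑B) z * pot A z else 0) := by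
      split_ifs
      · exact mul_nonneg (esc_nonneg _ _) hA0
      · exact le_rfl
    by_cases hA : z ∈ A
    · rw [if_pos hA, pot_of_mem hd hA]
      have : esc d (↑K) z ≤ esc d (↑A) z := esc_anti (by simp [hK]) z
      have := mul_le_mul_of_nonneg_right this hB0
      have e : esc d (↑K) z * (1 + pot B z - 1) = esc d (↑K) z * pot B z := by ring
      rw [pot_of_mem hd hA] at nB
      linarith
    · have hB : z ∈ B := by
        rcases Finset.mem_union.1 hz with h | h
        · exact absurd h hA
        · exact h
      rw [if_neg hA, if_pos hB, pot_of_mem hd hB]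
      have : esc d (↑K) z ≤ esc d (↑B) z := esc_anti (by simp [hK]) z
      have := mul_le_mul_of_nonneg_right this hA0
      have e : esc d (↑K) z * (pot A z + 1 - 1) = esc d (↑K) z * pot A z := by ring
      linarith
  have h3 := Finset.sum_le_sum h2
  rw [← h1, Finset.sum_add_distrib, Finset.sum_ite_mem, Finset.sum_ite_mem,
    Finset.inter_eq_right.2 Finset.subset_union_left,
    Finset.inter_eq_right.2 Finset.subset_union_right] at h3
  refine h3.trans (le_of_eq ?_)
  have h4 : ∑ z ∈ B, esc d (↑B) z * pot A z = ∑ z ∈ A, esc d (↑A) z * pot B z := by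
    simp only [pot, Finset.mul_sum]
    rw [Finset.sum_comm]
    refine Finset.sum_congr rfl fun z _ => Finset.sum_congr rfl fun x _ => ?_
    rw [G_sub_comm]
    ring
  rw [h4, ← two_mul]
  rfl

/-- Domination principle for Green potentials. -/
lemma sum_G_le_pot {d : ℕ} (hd : 5 ≤ d) {ι : Type*} (I : Finset ι) (y : ι → V d)
    {A : Finset (V d)} {K : ℝ} (hK : 0 ≤ K) (hA : ∀ i ∈ I, y i ∈ A)
    (h : ∀ i ∈ I, ∑ j ∈ I, G d (y i - y j) ≤ K) (z : V d) :
    ∑ i ∈ I, G d (z - y i) ≤ K * pot A z := by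
  classical
  have hd0 : 0 < d := by omega
  have hstep : ∀ N z, ∑ i ∈ I, G d (z - y i) ≤
      K * hitBy d N (↑A) z + ∑ i ∈ I, tailG d N (z - y i) := by
    intro N
    induction N with
    | zero =>
      intro z
      simp only [G_eq_tailG]
      exact le_add_of_nonneg_left (mul_nonneg hK (hitBy_nonneg hd0 _ _ _))
    | succ N ih =>
      intro z
      by_cases hz : ∃ i ∈ I, z = y i
      · obtain ⟨i, hi, rfl⟩ := hz
        rw [hitBy_of_mem (Finset.mem_coe.2 (hA i hi)), mul_one]
        exact (h i hi).trans (le_add_of_nonneg_right (Finset.sum_nonneg fun _ _ => tailG_nonneg _))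
      · push Not at hz
        have e1 : ∑ i ∈ I, G d (z - y i) =
            (∑ e ∈ steps d, ∑ i ∈ I, G d (z + e - y i)) / ((2 * d : ℕ) : ℝ) := by
          rw [Finset.sum_comm, Finset.sum_div]
          refine Finset.sum_congr rfl fun i hi => ?_
          rw [G_eq_tailG, tailG_succ hd, hk_zero, if_neg (sub_ne_zero.2 (hz i hi)), zero_add,
            tailG_succ_eq hd]
          simp only [G_eq_tailG, sub_add_eq_add_sub]
        have e2 : ∑ i ∈ I, tailG d (N + 1) (z - y i) =
            (∑ e ∈ steps d, ∑ i ∈ I, tailG d N (z + e - y i)) / ((2 * d : ℕ) : ℝ) := by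
          rw [Finset.sum_comm, Finset.sum_div]
          refine Finset.sum_congr rfl fun i hi => ?_
          rw [tailG_succ_eq hd]
          simp only [sub_add_eq_add_sub]
        have e3 : (∑ e ∈ steps d, hitBy d N (↑A) (z + e)) / ((2 * d : ℕ) : ℝ) ≤
            hitBy d (N + 1) (↑A) z := by
          rw [sum_hitBy hd0, hitBy]
          have := noHit_nonneg (m := N + 1) (↑A) z
          split_ifs <;> linarith
        rw [e1, e2]
        refine le_trans ?_ (add_le_add_left (mul_le_mul_of_nonneg_left e3 hK) _)
        rw [← mul_div_assoc, ← add_div, Finset.mul_sum, ← Finset.sum_add_distrib]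
        gcongr
        exact ih _
  have h0 : Tendsto (fun N => ∑ i ∈ I, tailG d N (z - y i)) atTop (nhds 0) := by
    rw [← Finset.sum_const_zero (s := I)]
    exact tendsto_finsetSum _ fun i _ => tendsto_sum_nat_add fun n => hk d n (z - y i)
  have hlim := ((tendsto_hitBy hd A z).const_mul K).add h0
  rw [add_zero] at hlim
  exact ge_of_tendsto' hlim fun N => hstep N z

lemma sum_rpow_neg_le {δ : ℝ} (h0 : 0 ≤ δ) (h1 : δ < 1) (M : ℕ) :
    ∑ p ∈ range M, ((p : ℝ) + 1) ^ (-δ) ≤ 1 / (1 - δ) * (M : ℝ) ^ (1 - δ) := by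
  have hδ : 0 < 1 - δ := by linarith
  induction M with
  | zero => simp [Real.zero_rpow hδ.ne']
  | succ M ih =>
    rw [Finset.sum_range_succ]
    have hM : (0 : ℝ) < (M : ℝ) + 1 := by positivity
    have hx1 : 1 / ((M : ℝ) + 1) ≤ 1 := by rw [div_le_one hM]; linarith [M.cast_nonneg (α := ℝ)]
    have hb := rpow_one_add_le_one_add_mul_self (s := -(1 / ((M : ℝ) + 1))) (p := 1 - δ)
      (by linarith) hδ.le (by linarith)
    have e1 : 1 + -(1 / ((M : ℝ) + 1)) = M / (M + 1) := by field_simp; ring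
    rw [e1, Real.div_rpow (by positivity) hM.le, div_le_iff₀ (by positivity)] at hb
    have e2 : ((M : ℝ) + 1) ^ (1 - δ) = ((M : ℝ) + 1) * ((M : ℝ) + 1) ^ (-δ) := by
      rw [sub_eq_add_neg, Real.rpow_add hM, Real.rpow_one]
    have e3 : (1 + (1 - δ) * -(1 / ((M : ℝ) + 1))) * ((M : ℝ) + 1) ^ (1 - δ) =
        ((M : ℝ) + 1) ^ (1 - δ) - (1 - δ) * ((M : ℝ) + 1) ^ (-δ) := by
      rw [e2]; field_simp; ring
    rw [e3] at hb
    push_cast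
    have h3 : 1 / (1 - δ) * (M : ℝ) ^ (1 - δ) ≤
        1 / (1 - δ) * (((M : ℝ) + 1) ^ (1 - δ) - (1 - δ) * ((M : ℝ) + 1) ^ (-δ)) :=
      mul_le_mul_of_nonneg_left hb (by positivity)
    have h4 : 1 / (1 - δ) * (((M : ℝ) + 1) ^ (1 - δ) - (1 - δ) * ((M : ℝ) + 1) ^ (-δ)) =
        1 / (1 - δ) * ((M : ℝ) + 1) ^ (1 - δ) - ((M : ℝ) + 1) ^ (-δ) := by
      field_simp
    linarith

/-- Markov property: the later position inside a tail of Green's function is integrated out. -/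
lemma expN_mul_tailG {d : ℕ} (hd : 5 ≤ d) {a i i' : ℕ} (h : i ≤ i') (h' : i' ≤ a) (b : ℕ)
    (f : V d → ℝ) (y : V d) :
    expN d a (fun s => f (pos 0 s i) * tailG d b (pos 0 s i' - y)) =
      expN d a (fun s => f (pos 0 s i) * tailG d (b + (i' - i)) (pos 0 s i - y)) := by
  have hd0 : 0 < d := by omega
  obtain ⟨p, rfl⟩ := Nat.exists_eq_add_of_le h
  have e1 : expN d a (fun s => f (pos 0 s i) * tailG d b (pos 0 s (i + p) - y)) =
      expN d (i + p) (fun s => f (pos 0 s i) * tailG d b (pos 0 s (i + p) - y)) :=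
    expN_of_local hd0 (by intro s t; simp only [pos_join_le _ _ _ h, pos_join_le _ _ _ le_rfl]) h'
  have e2 : expN d a (fun s => f (pos 0 s i) * tailG d (b + (i + p - i)) (pos 0 s i - y)) =
      expN d i (fun s => f (pos 0 s i) * tailG d (b + (i + p - i)) (pos 0 s i - y)) :=
    expN_of_local hd0 (by intro s t; simp only [pos_join_le _ _ _ le_rfl]) (by omega)
  rw [e1, e2, expN_join]
  simp only [pos_join_le _ _ _ le_rfl, pos_join_add, expN_const_mul]
  congr 1
  funext s
  rw [← expN_tailG_add hd, Nat.add_sub_cancel_left]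
  congr 2
  funext t
  rw [pos_eq_add]
  congr 1
  abel

lemma expN_mul_tailG' {d : ℕ} (hd : 5 ≤ d) {a i i' : ℕ} (h : i ≤ i') (h' : i' ≤ a) (b : ℕ)
    (f : V d → ℝ) (y : V d) :
    expN d a (fun s => f (pos 0 s i) * tailG d b (y - pos 0 s i')) =
      expN d a (fun s => f (pos 0 s i) * tailG d (b + (i' - i)) (y - pos 0 s i)) := by
  simp only [tailG_sub_comm y]
  exact expN_mul_tailG hd h h' b f y

lemma expN_tailG_pos {d : ℕ} (hd : 5 ≤ d) {a i : ℕ} (h : i ≤ a) (b : ℕ) (y : V d) :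
    expN d a (fun s => tailG d b (pos 0 s i - y)) = tailG d (b + i) y := by
  have := expN_mul_tailG hd (Nat.zero_le i) h b (fun _ => 1) y
  simp only [one_mul, pos_zero, zero_sub, tailG_neg, Nat.sub_zero] at this
  rw [this, expN_const (by omega)]

lemma expN_comm {d a b : ℕ} (F : (ℕ → V d) → (ℕ → V d) → ℝ) :
    expN d a (fun s => expN d b (fun t => F s t)) =
      expN d b (fun t => expN d a (fun s => F s t)) := by
  simp only [expN_eq, Finset.sum_div]
  rw [Finset.sum_comm]
  refine Finset.sum_congr rfl fun t _ => Finset.sum_congr rfl fun s _ => ?_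
  rw [div_right_comm]

/-- The pair `(p, q)` costs at most the product of the two weights. -/
lemma rpow_le_mul {δ : ℝ} (hδ : 0 ≤ δ) {p q b : ℕ} (hp : p ≤ b) (hq : q ≤ b) :
    ((b : ℝ) + 1) ^ (-(2 * δ)) ≤ ((p : ℝ) + 1) ^ (-δ) * ((q : ℝ) + 1) ^ (-δ) := by
  have hb : (0 : ℝ) < (b : ℝ) + 1 := by positivity
  rw [show -(2 * δ) = -δ + -δ by ring, Real.rpow_add hb]
  have hp' : (p : ℝ) ≤ b := by exact_mod_cast hp
  have hq' : (q : ℝ) ≤ b := by exact_mod_cast hq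
  gcongr ?_ * ?_
  · exact Real.rpow_le_rpow_of_nonpos (by positivity) (by linarith) (by linarith)
  · exact Real.rpow_le_rpow_of_nonpos (by positivity) (by linarith) (by linarith)

section

variable {d : ℕ} {C δ : ℝ}

lemma expN_pair_le (hd : 5 ≤ d) (hδ : 0 ≤ δ) (hC : 0 < C)
    (hG : ∀ b z, tailG d b z ≤ C * ((b : ℝ) + 1) ^ (-(2 * δ))) {a b i j : ℕ}
    (hi : i ≤ a) (hj : j ≤ b) {F : V d → ℝ} {c : ℝ} (hc : 0 ≤ c)
    (hF : ∀ z, F z ≤ c * G d z) :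
    expN d a (fun s => expN d b (fun t => F (pos 0 s i - pos 0 t j))) ≤
      c * (C * (((i : ℝ) + 1) ^ (-δ) * ((j : ℝ) + 1) ^ (-δ))) := by
  calc _ ≤ expN d a (fun s => expN d b (fun t => c * G d (pos 0 s i - pos 0 t j))) :=
        expN_mono fun s => expN_mono fun t => hF _
    _ = c * tailG d (i + j) 0 := by
        rw [expN_comm]
        simp only [expN_const_mul, G_eq_tailG, expN_tailG_pos hd hi, zero_add]
        have := expN_tailG_pos hd hj i 0
        simp only [sub_zero] at this
        rw [this]
    _ ≤ _ := by
        refine mul_le_mul_of_nonneg_left ((hG _ _).trans ?_) hc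
        exact mul_le_mul_of_nonneg_left (rpow_le_mul hδ (by omega) (by omega)) hC.le

lemma expN_quad_le_aux (hd : 5 ≤ d) (hδ : 0 ≤ δ) (hC : 0 < C)
    (hG : ∀ b z, tailG d b z ≤ C * ((b : ℝ) + 1) ^ (-(2 * δ))) {a b i i' j j' : ℕ}
    (hi : i ≤ i') (hi' : i' ≤ a) (hj : j ≤ b) (hj' : j' ≤ b) :
    expN d a (fun s => expN d b (fun t =>
        G d (pos 0 s i - pos 0 t j) * G d (pos 0 s i' - pos 0 t j'))) ≤
      C ^ 2 * ((((max i i' - min i i' : ℕ) : ℝ) + 1) ^ (-δ) * (((min i i' : ℕ) : ℝ) + 1) ^ (-δ)) *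
        ((((max j j' - min j j' : ℕ) : ℝ) + 1) ^ (-δ) * (((min j j' : ℕ) : ℝ) + 1) ^ (-δ)) := by
  rw [max_eq_right hi, min_eq_left hi]
  have e1 : expN d a (fun s => expN d b (fun t =>
        G d (pos 0 s i - pos 0 t j) * G d (pos 0 s i' - pos 0 t j'))) =
      expN d a (fun s => expN d b (fun t =>
        G d (pos 0 s i - pos 0 t j) * tailG d (i' - i) (pos 0 s i - pos 0 t j'))) := by
    rw [expN_comm]
    conv_rhs => rw [expN_comm]
    congr 1
    funext t
    have := expN_mul_tailG hd hi hi' 0 (fun x => G d (x - pos 0 t j)) (pos 0 t j')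
    rwa [zero_add] at this
  rw [e1]
  rcases le_total j j' with h | h
  · rw [max_eq_right h, min_eq_left h]
    have e2 : ∀ s : ℕ → V d, expN d b (fun t =>
        G d (pos 0 s i - pos 0 t j) * tailG d (i' - i) (pos 0 s i - pos 0 t j')) =
        expN d b (fun t =>
        G d (pos 0 s i - pos 0 t j) * tailG d (i' - i + (j' - j)) (pos 0 s i - pos 0 t j)) :=
      fun s => expN_mul_tailG' hd h hj' _ (fun y => G d (pos 0 s i - y)) _
    simp only [e2]
    refine (expN_pair_le hd hδ hC hG (hi.trans hi') hj (F := fun z =>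
      G d z * tailG d (i' - i + (j' - j)) z)
      (c := C * ((((i' - i : ℕ) : ℝ) + 1) ^ (-δ) * (((j' - j : ℕ) : ℝ) + 1) ^ (-δ)))
      (by positivity) fun z => ?_).trans (le_of_eq (by ring))
    rw [mul_comm]
    refine mul_le_mul_of_nonneg_right ((hG _ _).trans ?_) (G_nonneg _)
    exact mul_le_mul_of_nonneg_left (rpow_le_mul hδ (by omega) (by omega)) hC.le
  · rw [max_eq_left h, min_eq_right h]
    have e2 : ∀ s : ℕ → V d, expN d b (fun t =>
        G d (pos 0 s i - pos 0 t j) * tailG d (i' - i) (pos 0 s i - pos 0 t j')) =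
        expN d b (fun t =>
        tailG d (i' - i) (pos 0 s i - pos 0 t j') * tailG d (j - j') (pos 0 s i - pos 0 t j')) := by
      intro s
      have := expN_mul_tailG' hd h hj 0 (fun y => tailG d (i' - i) (pos 0 s i - y)) (pos 0 s i)
      rw [zero_add] at this
      rw [← this]
      congr 1
      funext t
      exact mul_comm _ _
    simp only [e2]
    have h4 := expN_pair_le hd hδ hC hG (hi.trans hi') hj' (F := fun z =>
      tailG d (i' - i) z * tailG d (j - j') z)
      (c := C * ((((i' - i : ℕ) : ℝ) + 1) ^ (-δ) * (((j - j' : ℕ) : ℝ) + 1) ^ (-δ)))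
      (by positivity)
    refine (h4 fun z => ?_).trans (le_of_eq (by ring))
    have hz : ∀ u : ℕ, tailG d u z ≤ G d z := by
      intro u
      rw [G_eq_tailG]
      exact tailG_antitone hd z (Nat.zero_le u)
    rcases le_total (i' - i) (j - j') with h2 | h2
    · rw [mul_comm]
      refine mul_le_mul ((hG _ _).trans ?_) (hz _) (tailG_nonneg _) (by positivity)
      exact mul_le_mul_of_nonneg_left (rpow_le_mul hδ h2 le_rfl) hC.le
    · refine mul_le_mul ((hG _ _).trans ?_) (hz _) (tailG_nonneg _) (by positivity)
      exact mul_le_mul_of_nonneg_left (rpow_le_mul hδ le_rfl h2) hC.le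

lemma expN_quad_le (hd : 5 ≤ d) (hδ : 0 ≤ δ) (hC : 0 < C)
    (hG : ∀ b z, tailG d b z ≤ C * ((b : ℝ) + 1) ^ (-(2 * δ))) {a b i i' j j' : ℕ}
    (hi : i ≤ a) (hi' : i' ≤ a) (hj : j ≤ b) (hj' : j' ≤ b) :
    expN d a (fun s => expN d b (fun t =>
        G d (pos 0 s i - pos 0 t j) * G d (pos 0 s i' - pos 0 t j'))) ≤
      C ^ 2 * ((((max i i' - min i i' : ℕ) : ℝ) + 1) ^ (-δ) * (((min i i' : ℕ) : ℝ) + 1) ^ (-δ)) *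
        ((((max j j' - min j j' : ℕ) : ℝ) + 1) ^ (-δ) * (((min j j' : ℕ) : ℝ) + 1) ^ (-δ)) := by
  rcases le_total i i' with h | h
  · exact expN_quad_le_aux hd hδ hC hG h hi' hj hj'
  · have := expN_quad_le_aux hd hδ hC hG h hi hj' hj
    rw [max_comm i', min_comm i', max_comm j', min_comm j'] at this
    refine le_of_eq_of_le ?_ this
    congr 1
    funext s
    congr 1
    funext t
    exact mul_comm _ _

end

lemma sum_sum_le_two_mul (v w : ℕ → ℝ) (hv : ∀ p, 0 ≤ v p) (hw : ∀ p, 0 ≤ w p) (m : ℕ) :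
    ∑ i ∈ range m, ∑ i' ∈ range m, v (max i i' - min i i') * w (min i i') ≤
      2 * ((∑ p ∈ range m, v p) * ∑ p ∈ range m, w p) := by
  have h1 : ∀ i ∈ range m, ∀ i' ∈ range m, v (max i i' - min i i') * w (min i i') ≤
      (if i ≤ i' then v (i' - i) * w i else 0) + (if i' ≤ i then v (i - i') * w i' else 0) := by
    intro i _ i' _
    rcases lt_trichotomy i i' with h | h | h
    · simp [h.le, h.not_ge]
    · subst h
      simp [mul_nonneg (hv _) (hw _)]
    · simp [h.le, h.not_ge]
  have h2 : ∀ i ∈ range m, ∑ i' ∈ range m, (if i ≤ i' then v (i' - i) * w i else 0) ≤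
      (∑ p ∈ range m, v p) * w i := by
    intro i hi
    rw [← Finset.sum_filter, Finset.sum_mul]
    have : ∑ i' ∈ range m with i ≤ i', v (i' - i) * w i =
        ∑ p ∈ (Finset.filter (fun i' => i ≤ i') (range m)).image (fun i' => i' - i), v p * w i := by
      rw [Finset.sum_image]
      intro x hx y hy hxy
      simp only [Finset.coe_filter, Set.mem_ofPred_eq] at hx hy
      simp only at hxy
      omega
    rw [this]
    refine Finset.sum_le_sum_of_subset_of_nonneg ?_ fun p _ _ => mul_nonneg (hv _) (hw _)
    intro p hp
    simp only [Finset.mem_image, Finset.mem_filter, Finset.mem_range] at hp ⊢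
    obtain ⟨x, hx, rfl⟩ := hp
    omega
  have h3 : ∑ i ∈ range m, ∑ i' ∈ range m, (if i ≤ i' then v (i' - i) * w i else 0) ≤
      (∑ p ∈ range m, v p) * ∑ p ∈ range m, w p := by
    refine (Finset.sum_le_sum h2).trans (le_of_eq ?_)
    rw [← Finset.mul_sum]
  refine (Finset.sum_le_sum fun i hi => Finset.sum_le_sum fun i' hi' => h1 i hi i' hi').trans ?_
  simp only [Finset.sum_add_distrib]
  rw [Finset.sum_comm (f := fun i i' => if i' ≤ i then v (i - i') * w i' else 0)]
  linarith

/-- Second moment of the mutual energy of two independent walks. -/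
lemma expN_sq_energy_le {d : ℕ} (hd : 5 ≤ d) {C δ : ℝ} (hδ : 0 ≤ δ) (hδ1 : δ < 1) (hC : 0 < C)
    (hG : ∀ b z, tailG d b z ≤ C * ((b : ℝ) + 1) ^ (-(2 * δ))) {a b N : ℕ}
    (ha : a ≤ N) (hb : b ≤ N) :
    expN d a (fun s => expN d b (fun t =>
      (∑ i ∈ range (a + 1), ∑ j ∈ range (b + 1), G d (pos 0 s i - pos 0 t j)) ^ 2)) ≤
      4 * C ^ 2 * (1 / (1 - δ) * ((N + 1 : ℕ) : ℝ) ^ (1 - δ)) ^ 4 := by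
  set w : ℕ → ℝ := fun p => ((p : ℝ) + 1) ^ (-δ) with hw
  have hw0 : ∀ p, 0 ≤ w p := fun p => by positivity
  have e : ∀ s t : ℕ → V d,
      (∑ i ∈ range (a + 1), ∑ j ∈ range (b + 1), G d (pos 0 s i - pos 0 t j)) ^ 2 =
      ∑ i ∈ range (a + 1), ∑ i' ∈ range (a + 1), ∑ j ∈ range (b + 1), ∑ j' ∈ range (b + 1),
        G d (pos 0 s i - pos 0 t j) * G d (pos 0 s i' - pos 0 t j') := by
    intro s t
    rw [sq, Finset.sum_mul_sum]
    refine Finset.sum_congr rfl fun i _ => Finset.sum_congr rfl fun i' _ => ?_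
    rw [Finset.sum_mul_sum]
  simp only [e, expN_sum]
  have hS : ∀ m ≤ N, ∑ p ∈ range (m + 1), w p ≤ 1 / (1 - δ) * ((N + 1 : ℕ) : ℝ) ^ (1 - δ) := by
    intro m hm
    refine le_trans ?_ (sum_rpow_neg_le hδ hδ1 (N + 1))
    exact Finset.sum_le_sum_of_subset_of_nonneg (Finset.range_mono (by omega)) fun p _ _ => hw0 p
  have hS0 : ∀ m, 0 ≤ ∑ p ∈ range (m + 1), w p := fun m => Finset.sum_nonneg fun p _ => hw0 p
  calc _ ≤ ∑ i ∈ range (a + 1), ∑ i' ∈ range (a + 1), ∑ j ∈ range (b + 1), ∑ j' ∈ range (b + 1),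
        C ^ 2 * (w (max i i' - min i i') * w (min i i')) *
          (w (max j j' - min j j') * w (min j j')) := by
        refine Finset.sum_le_sum fun i hi => Finset.sum_le_sum fun i' hi' =>
          Finset.sum_le_sum fun j hj => Finset.sum_le_sum fun j' hj' => ?_
        rw [Finset.mem_range] at hi hi' hj hj'
        exact expN_quad_le hd hδ hC hG (by omega) (by omega) (by omega) (by omega)
    _ = C ^ 2 * (∑ i ∈ range (a + 1), ∑ i' ∈ range (a + 1),
          w (max i i' - min i i') * w (min i i')) *
        (∑ j ∈ range (b + 1), ∑ j' ∈ range (b + 1), w (max j j' - min j j') * w (min j j')) := by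
        simp only [← Finset.mul_sum, ← Finset.sum_mul]
    _ ≤ C ^ 2 * (2 * ((∑ p ∈ range (a + 1), w p) * ∑ p ∈ range (a + 1), w p)) *
        (2 * ((∑ p ∈ range (b + 1), w p) * ∑ p ∈ range (b + 1), w p)) := by
        gcongr
        · exact sum_sum_le_two_mul w w hw0 hw0 _
        · exact sum_sum_le_two_mul w w hw0 hw0 _
    _ ≤ C ^ 2 * (2 * (1 / (1 - δ) * ((N + 1 : ℕ) : ℝ) ^ (1 - δ)) ^ 2) *
        (2 * (1 / (1 - δ) * ((N + 1 : ℕ) : ℝ) ^ (1 - δ)) ^ 2) := by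
        rw [← sq, ← sq]
        gcongr
        · exact hS a ha
        · exact hS b hb
    _ = _ := by ring

/-- The range of the walk up to time `n`. -/
noncomputable abbrev rng {d : ℕ} (x : V d) (s : ℕ → V d) (n : ℕ) : Finset (V d) :=
  rangeOn x s (Finset.Icc 0 n)

lemma mem_rng {d n : ℕ} {x y : V d} {s : ℕ → V d} : y ∈ rng x s n ↔ ∃ k ≤ n, pos x s k = y := by
  simp [rng, rangeOn]

lemma rng_translate {d n : ℕ} (x : V d) (s : ℕ → V d) :
    rng x s n = (rng 0 s n).image fun y => x + y := by
  ext y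
  simp only [Finset.mem_image, mem_rng]
  constructor
  · rintro ⟨k, hk, rfl⟩
    exact ⟨_, ⟨k, hk, rfl⟩, (pos_eq_add x s k).symm⟩
  · rintro ⟨_, ⟨k, hk, rfl⟩, rfl⟩
    exact ⟨k, hk, pos_eq_add x s k⟩

lemma cap_rng_translate {d n : ℕ} (x : V d) (s : ℕ → V d) : cap (rng x s n) = cap (rng 0 s n) := by
  rw [rng_translate, cap_translate]

lemma rng_join {d a b : ℕ} (x : V d) (s t : ℕ → V d) :
    rng x (joinSteps a s t) (a + b) = rng x s a ∪ rng (pos x s a) t b := by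
  ext y
  simp only [Finset.mem_union, mem_rng]
  constructor
  · rintro ⟨k, hk, rfl⟩
    rcases le_total k a with h | h
    · exact Or.inl ⟨k, h, (pos_join_le x s t h).symm⟩
    · obtain ⟨j, rfl⟩ := Nat.exists_eq_add_of_le h
      exact Or.inr ⟨j, by omega, (pos_join_add x s t).symm⟩
  · rintro (⟨k, hk, rfl⟩ | ⟨k, hk, rfl⟩)
    · exact ⟨k, by omega, pos_join_le x s t hk⟩
    · exact ⟨a + k, by omega, pos_join_add x s t⟩

lemma rng_join_le {d a m : ℕ} (h : m ≤ a) (x : V d) (s t : ℕ → V d) :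
    rng x (joinSteps a s t) m = rng x s m := by
  ext y
  simp only [mem_rng]
  constructor
  · rintro ⟨k, hk, rfl⟩
    exact ⟨k, hk, (pos_join_le x s t (by omega)).symm⟩
  · rintro ⟨k, hk, rfl⟩
    exact ⟨k, hk, pos_join_le x s t (by omega)⟩

lemma cap_join {d a b : ℕ} (s t : ℕ → V d) :
    cap (rng 0 (joinSteps a s t) (a + b)) =
      cap (rng 0 s a) + cap (rng 0 t b) - chiC (rng 0 s a) (rng (pos 0 s a) t b) := by
  rw [rng_join, chiC, cap_rng_translate (pos 0 s a) t]
  ring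

lemma sum_rng_le {d n : ℕ} (x : V d) (s : ℕ → V d) {f : V d → ℝ} (hf : ∀ y, 0 ≤ f y)
    (A : Set (V d)) :
    ∑ y ∈ rng x s n, esc d A y * f y ≤ ∑ k ∈ range (n + 1), f (pos x s k) := by
  calc _ ≤ ∑ y ∈ rng x s n, f y :=
        Finset.sum_le_sum fun y _ => mul_le_of_le_one_left (hf y) (esc_le_one _ _)
    _ ≤ _ := by
        rw [rng, rangeOn, ← Nat.range_succ_eq_Icc_zero]
        exact Finset.sum_image_le_of_nonneg fun _ _ => hf _

lemma card_rng_le {d n : ℕ} (x : V d) (s : ℕ → V d) : (rng x s n).card ≤ n + 1 := by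
  refine Finset.card_image_le.trans ?_
  simp

lemma cap_rng_le {d n : ℕ} (x : V d) (s : ℕ → V d) : cap (rng x s n) ≤ n + 1 :=
  (cap_le_card _).trans (by exact_mod_cast card_rng_le x s)

lemma chiC_rng_le {d n : ℕ} (hd : 5 ≤ d) (A : Finset (V d)) (x : V d) (t : ℕ → V d) :
    chiC A (rng x t n) ≤
      2 * ∑ y ∈ A, esc d (↑A) y * ∑ j ∈ range (n + 1), G d (y - pos x t j) := by
  refine (chiC_le hd A _).trans ?_
  gcongr with y hy
  · exact esc_nonneg _ _
  · exact sum_rng_le x t (fun z => G_nonneg _) _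

lemma chiC_rng_rng_le {d a b : ℕ} (hd : 5 ≤ d) (x y : V d) (s t : ℕ → V d) :
    chiC (rng x s a) (rng y t b) ≤
      2 * ∑ i ∈ range (a + 1), ∑ j ∈ range (b + 1), G d (pos x s i - pos y t j) := by
  refine (chiC_rng_le hd _ y t).trans ?_
  gcongr
  exact sum_rng_le (f := fun z => ∑ j ∈ range (b + 1), G d (z - pos y t j)) x s
    (fun z => Finset.sum_nonneg fun _ _ => G_nonneg _) _

/-- Variance of the capacity of the range. -/
noncomputable def varCap (d n : ℕ) : ℝ :=
  expN d n (fun s => (cap (rng 0 s n) - expCapRange d n) ^ 2)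

lemma varCap_nonneg {d n : ℕ} : 0 ≤ varCap d n := expN_nonneg fun _ => sq_nonneg _

lemma varCap_le {d n : ℕ} (hd : 0 < d) (c : ℝ) :
    varCap d n ≤ expN d n (fun s => (cap (rng 0 s n) - c) ^ 2) := by
  have e : ∀ c : ℝ, expN d n (fun s => (cap (rng 0 s n) - c) ^ 2) =
      expN d n (fun s => cap (rng 0 s n) ^ 2) - 2 * c * expCapRange d n + c ^ 2 := by
    intro c
    have : ∀ s : ℕ → V d, (cap (rng 0 s n) - c) ^ 2 =
        cap (rng 0 s n) ^ 2 - 2 * c * cap (rng 0 s n) + c ^ 2 := fun s => by ring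
    simp only [this]
    rw [expN_add, expN_sub, expN_const_mul, expN_const hd]
    rfl
  rw [varCap, e, e]
  nlinarith [sq_nonneg (expCapRange d n - c)]

lemma energy_rev {d a b : ℕ} (s t : ℕ → V d) :
    ∑ i ∈ range (a + 1), ∑ j ∈ range (b + 1), G d (pos 0 s i - pos (pos 0 s a) t j) =
      ∑ i ∈ range (a + 1), ∑ j ∈ range (b + 1),
        G d (pos 0 (revSteps a s) i - pos 0 (-t) j) := by
  rw [← Finset.sum_range_reflect]
  refine Finset.sum_congr rfl fun i hi => Finset.sum_congr rfl fun j _ => ?_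
  have hi' : i ≤ a := by rw [Finset.mem_range] at hi; omega
  have h2 : a + 1 - 1 - i = a - i := by omega
  rw [pos_rev s hi', pos_neg, pos_eq_add (pos 0 s a), G_sub_comm, h2]
  congr 1
  abel

/-- Second moment of the cross-term between the past and the future of the walk. -/
lemma expN_sq_chiC_le {d : ℕ} (hd : 5 ≤ d) {C δ : ℝ} (hδ : 0 ≤ δ) (hδ1 : δ < 1) (hC : 0 < C)
    (hG : ∀ b z, tailG d b z ≤ C * ((b : ℝ) + 1) ^ (-(2 * δ))) {a b N : ℕ}
    (ha : a ≤ N) (hb : b ≤ N) :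
    expN d a (fun s => expN d b (fun t => chiC (rng 0 s a) (rng (pos 0 s a) t b) ^ 2)) ≤
      16 * C ^ 2 * (1 / (1 - δ) * ((N + 1 : ℕ) : ℝ) ^ (1 - δ)) ^ 4 := by
  have key : ∀ s t : ℕ → V d, chiC (rng 0 s a) (rng (pos 0 s a) t b) ^ 2 ≤
      4 * (∑ i ∈ range (a + 1), ∑ j ∈ range (b + 1),
        G d (pos 0 s i - pos (pos 0 s a) t j)) ^ 2 := by
    intro s t
    have h1 := chiC_rng_rng_le hd (a := a) (b := b) 0 (pos 0 s a) s t
    have h2 := chiC_nonneg (rng 0 s a) (rng (pos 0 s a) t b)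
    nlinarith
  have flip : expN d a (fun s => expN d b (fun t => (∑ i ∈ range (a + 1), ∑ j ∈ range (b + 1),
      G d (pos 0 s i - pos (pos 0 s a) t j)) ^ 2)) =
      expN d a (fun s => expN d b (fun t => (∑ i ∈ range (a + 1), ∑ j ∈ range (b + 1),
        G d (pos 0 s i - pos 0 t j)) ^ 2)) := by
    rw [expN_rev (m := a) (fun s => expN d b (fun t => (∑ i ∈ range (a + 1), ∑ j ∈ range (b + 1),
        G d (pos 0 s i - pos 0 t j)) ^ 2))]
    simp only [energy_rev]
    refine congrArg (expN d a) (funext fun s => ?_)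
    exact (expN_neg (m := b) (fun t => (∑ i ∈ range (a + 1),
      ∑ j ∈ range (b + 1), G d (pos 0 (revSteps a s) i - pos 0 t j)) ^ 2)).symm
  refine (expN_mono fun s => expN_mono fun t => key s t).trans ?_
  simp only [expN_const_mul]
  rw [flip]
  have := expN_sq_energy_le hd hδ hδ1 hC hG ha hb
  linarith

lemma expN_cap_sub {d n : ℕ} (hd : 0 < d) :
    expN d n (fun s => cap (rng 0 s n) - expCapRange d n) = 0 := by
  rw [expN_sub, expN_const hd]
  exact sub_self _

lemma varCap_add_le {d : ℕ} (hd : 5 ≤ d) {a b : ℕ} {ε : ℝ} (hε : 0 < ε) :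
    varCap d (a + b) ≤ (1 + ε) * (varCap d a + varCap d b) + (1 + 1 / ε) *
      expN d a (fun s => expN d b (fun t => chiC (rng 0 s a) (rng (pos 0 s a) t b) ^ 2)) := by
  have hd0 : 0 < d := by omega
  refine (varCap_le hd0 (expCapRange d a + expCapRange d b)).trans ?_
  rw [expN_join]
  have h1 : ∀ s t : ℕ → V d,
      (cap (rng 0 (joinSteps a s t) (a + b)) - (expCapRange d a + expCapRange d b)) ^ 2 ≤
      (1 + ε) * ((cap (rng 0 s a) - expCapRange d a) ^ 2 +
        (cap (rng 0 t b) - expCapRange d b) ^ 2 +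
        2 * (cap (rng 0 s a) - expCapRange d a) * (cap (rng 0 t b) - expCapRange d b)) +
      (1 + 1 / ε) * chiC (rng 0 s a) (rng (pos 0 s a) t b) ^ 2 := by
    intro s t
    rw [cap_join]
    set u := cap (rng 0 s a) - expCapRange d a with hu
    set v := cap (rng 0 t b) - expCapRange d b with hv
    set χ := chiC (rng 0 s a) (rng (pos 0 s a) t b)
    have e : cap (rng 0 s a) + cap (rng 0 t b) - χ - (expCapRange d a + expCapRange d b) =
        (u + v) - χ := by rw [hu, hv]; ring
    rw [e]
    have h : 0 ≤ (ε * (u + v) + χ) ^ 2 / ε := by positivity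
    have e2 : (ε * (u + v) + χ) ^ 2 / ε =
        ε * (u + v) ^ 2 + 2 * (u + v) * χ + 1 / ε * χ ^ 2 := by field_simp; ring
    nlinarith
  refine (expN_mono fun s => expN_mono fun t => h1 s t).trans (le_of_eq ?_)
  simp only [expN_add, expN_const_mul, expN_const hd0, expN_cap_sub hd0, mul_zero, add_zero]
  rfl

lemma varCap_le_four {d n : ℕ} (hd : 0 < d) (hn : n ≤ 1) : varCap d n ≤ 4 := by
  refine (varCap_le hd 0).trans ((expN_mono fun s => ?_).trans (expN_const (n := n) hd 4).le)
  have h1 := cap_rng_le (n := n) 0 s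
  have h2 := cap_nonneg (rng 0 s n)
  have h3 : (n : ℝ) ≤ 1 := by exact_mod_cast hn
  nlinarith

lemma varCap_two_pow_succ {d : ℕ} (hd : 5 ≤ d) {C δ : ℝ} (hδ : 0 ≤ δ) (hδ1 : δ < 1) (hC : 0 < C)
    (hG : ∀ b z, tailG d b z ≤ C * ((b : ℝ) + 1) ^ (-(2 * δ))) {k : ℕ} {ε B : ℝ} (hε : 0 < ε)
    (hB : ∀ n ≤ 2 ^ k, varCap d n ≤ B) {n : ℕ} (hn : n ≤ 2 ^ (k + 1)) :
    varCap d n ≤ 2 * (1 + ε) * B + (1 + 1 / ε) *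
      (16 * C ^ 2 * (1 / (1 - δ) * ((2 ^ k + 1 : ℕ) : ℝ) ^ (1 - δ)) ^ 4) := by
  rw [pow_succ] at hn
  have h1 : n / 2 ≤ 2 ^ k := by omega
  have h2 : n - n / 2 ≤ 2 ^ k := by omega
  have h := varCap_add_le hd (a := n / 2) (b := n - n / 2) hε
  rw [show n / 2 + (n - n / 2) = n by omega] at h
  refine h.trans ?_
  rw [show 2 * (1 + ε) * B = (1 + ε) * (B + B) by ring]
  gcongr
  · exact hB _ h1
  · exact hB _ h2
  · exact expN_sq_chiC_le hd hδ hδ1 hC hG h1 h2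

lemma exists_two_pow (T : ℕ) (hT : 1 ≤ T) : ∃ k : ℕ, T ≤ 2 ^ k ∧ 2 ^ k ≤ 2 * T := by
  obtain ⟨k, h1, h2⟩ := exists_nat_pow_near hT (by norm_num : 1 < 2)
  exact ⟨k + 1, h2.le, by rw [pow_succ]; omega⟩

lemma exists_varCap_le {d : ℕ} (hd : 5 ≤ d) :
    ∃ K : ℝ, 0 < K ∧ ∀ T : ℕ, 1 ≤ T → ∀ r ≤ T, varCap d r ≤ K * (T * Real.sqrt T) := by
  have h5 : (5 : ℝ) ≤ d := by exact_mod_cast hd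
  obtain ⟨C, hC, hG⟩ := exists_tailG_le (d := d) (γ := 2 * (3 / 4)) (by omega) (by norm_num)
    (by linarith)
  set D : ℝ := 16 * C ^ 2 * 512 with hD
  have hD0 : 0 < D := by positivity
  have hσ : (1.4 : ℝ) ≤ √2 := by rw [Real.le_sqrt'] <;> norm_num
  have key : ∀ k : ℕ, ∀ n ≤ 2 ^ k, varCap d n ≤ (4 + 15 * D) * (2 * √2) ^ k := by
    intro k
    induction k with
    | zero =>
      intro n hn
      have := varCap_le_four (d := d) (by omega) (by simpa using hn)
      rw [pow_zero, mul_one]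
      linarith
    | succ k ih =>
      intro n hn
      refine (varCap_two_pow_succ hd (by norm_num) (by norm_num) hC hG (ε := 1 / 5) (by norm_num)
        ih hn).trans ?_
      have e : ((2 ^ k + 1 : ℕ) : ℝ) ≤ 2 * 2 ^ k := by
        have : (1 : ℝ) ≤ 2 ^ k := one_le_pow₀ (by norm_num)
        push_cast
        linarith
      have e2 : (1 / (1 - 3 / 4) * ((2 ^ k + 1 : ℕ) : ℝ) ^ (1 - 3 / 4 : ℝ)) ^ 4 =
          256 * ((2 ^ k + 1 : ℕ) : ℝ) := by
        rw [mul_pow, ← Real.rpow_natCast (_ ^ _), ← Real.rpow_mul (by positivity)]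
        norm_num
      rw [e2]
      have e3 : (2 : ℝ) ^ k ≤ (2 * √2) ^ k := pow_le_pow_left₀ (by norm_num) (by linarith) _
      have h4 : 16 * C ^ 2 * (256 * ((2 ^ k + 1 : ℕ) : ℝ)) ≤ D * (2 * √2) ^ k := by
        calc _ ≤ 16 * C ^ 2 * (256 * (2 * 2 ^ k)) := by gcongr
          _ = D * 2 ^ k := by rw [hD]; ring
          _ ≤ _ := by gcongr
      have h5 : 1.4 * ((4 + 15 * D) * (2 * √2) ^ k) ≤ √2 * ((4 + 15 * D) * (2 * √2) ^ k) := by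
        gcongr
      have h6 : 0 ≤ (2 * √2) ^ k := by positivity
      rw [pow_succ (2 * √2)]
      linarith
  refine ⟨(4 + 15 * D) * 4, by positivity, fun T hT r hr => ?_⟩
  obtain ⟨k, h1, h2⟩ := exists_two_pow T hT
  refine (key k r (hr.trans h1)).trans ?_
  have h2' : (2 : ℝ) ^ k ≤ 2 * T := by exact_mod_cast h2
  have h3 : (2 * √2) ^ k ≤ 4 * (T * √T) := by
    have e : (√2) ^ k = √(2 ^ k) := by
      rw [Real.sqrt_eq_rpow, Real.sqrt_eq_rpow, ← Real.rpow_natCast, ← Real.rpow_natCast,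
        ← Real.rpow_mul (by norm_num), ← Real.rpow_mul (by norm_num), mul_comm]
    have e2 : √(2 ^ k) ≤ 2 * √T := by
      rw [Real.sqrt_le_left (by positivity), mul_pow, Real.sq_sqrt (by positivity)]
      linarith [T.cast_nonneg (α := ℝ)]
    rw [mul_pow, e]
    calc _ ≤ (2 * T) * (2 * √T) := by gcongr
      _ = _ := by ring
  calc _ ≤ (4 + 15 * D) * (4 * (T * √T)) := by gcongr
    _ = _ := by ring

lemma exists_varCap_le_of_six {d : ℕ} (hd : 6 ≤ d) :
    ∃ K : ℝ, 0 < K ∧ ∀ T : ℕ, 1 ≤ T → ∀ r ≤ T, varCap d r ≤ K * T := by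
  have h6 : (6 : ℝ) ≤ d := by exact_mod_cast hd
  have hd5 : 5 ≤ d := by omega
  obtain ⟨C, hC, hG⟩ := exists_tailG_le (d := d) (γ := 2 * (7 / 8)) (by omega) (by norm_num)
    (by linarith)
  set D : ℝ := 16 * C ^ 2 * 8192 with hD
  have hD0 : 0 < D := by positivity
  set q : ℝ := √(√2) with hq
  have hq2 : q ^ 2 = √2 := Real.sq_sqrt (by positivity)
  have hq4 : q ^ 4 = 2 := by
    rw [show q ^ 4 = (q ^ 2) ^ 2 by ring, hq2, Real.sq_sqrt (by norm_num)]
  have hq0 : 0 ≤ q := Real.sqrt_nonneg _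
  have hq1 : 1 < q := by
    by_contra! h
    have : q ^ 4 ≤ 1 := pow_le_one₀ hq0 h
    linarith
  set ρ : ℝ := q⁻¹ with hρ
  have hρ0 : 0 < ρ := by positivity
  have hρ1 : ρ < 1 := inv_lt_one_of_one_lt₀ hq1
  have key : ∀ k : ℕ, ∀ n ≤ 2 ^ k, varCap d n ≤
      2 ^ k * ((4 + D) * Real.exp (∑ j ∈ range k, ρ ^ j) - D) := by
    intro k
    induction k with
    | zero =>
      intro n hn
      have := varCap_le_four (d := d) (by omega) (by simpa using hn)
      simp only [pow_zero, Finset.sum_range_zero, Real.exp_zero]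
      linarith
    | succ k ih =>
      intro n hn
      have hρk : 0 < ρ ^ k := by positivity
      refine (varCap_two_pow_succ hd5 (by norm_num) (by norm_num) hC hG hρk ih hn).trans ?_
      set B := (4 + D) * Real.exp (∑ j ∈ range k, ρ ^ j) with hB
      have hB0 : 0 < B := by positivity
      have e2 : (1 / (1 - 7 / 8) * ((2 ^ k + 1 : ℕ) : ℝ) ^ (1 - 7 / 8 : ℝ)) ^ 4 =
          4096 * √((2 ^ k + 1 : ℕ) : ℝ) := by
        rw [mul_pow, ← Real.rpow_natCast (_ ^ _), ← Real.rpow_mul (by positivity),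
          Real.sqrt_eq_rpow]
        norm_num
      set Q := q ^ k with hQ
      have hQ1 : 1 ≤ Q := one_le_pow₀ hq1.le
      have e2k : (2 : ℝ) ^ k = Q ^ 4 := by rw [hQ, ← pow_mul, mul_comm, pow_mul, hq4]
      have eρ : ρ ^ k = Q⁻¹ := by rw [hρ, inv_pow]
      have e : √((2 ^ k + 1 : ℕ) : ℝ) ≤ 2 * Q ^ 2 := by
        rw [Real.sqrt_le_left (by positivity)]
        push_cast
        rw [e2k]
        nlinarith [one_le_pow₀ hQ1 (n := 4)]
      rw [e2, Finset.sum_range_succ, Real.exp_add, ← mul_assoc (4 + D), ← hB, pow_succ (2 : ℝ) k, e2k]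
      have hexp : 1 + ρ ^ k ≤ Real.exp (ρ ^ k) := by
        have := Real.add_one_le_exp (ρ ^ k)
        linarith
      have hQ0 : 0 < Q := by positivity
      have hBB : B * (1 + Q⁻¹) ≤ B * Real.exp (ρ ^ k) := by
        rw [← eρ]
        gcongr
      have h3 : (1 + 1 / ρ ^ k) * (16 * C ^ 2 * (4096 * √((2 ^ k + 1 : ℕ) : ℝ))) ≤
          (1 + Q) * (D * Q ^ 2) := by
        rw [eρ, one_div, inv_inv, hD]
        have : 16 * C ^ 2 * (4096 * √((2 ^ k + 1 : ℕ) : ℝ)) ≤ 16 * C ^ 2 * (4096 * (2 * Q ^ 2)) := by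
          gcongr
        calc _ ≤ (1 + Q) * (16 * C ^ 2 * (4096 * (2 * Q ^ 2))) := by gcongr
          _ = _ := by ring
      have h4 : (1 + Q) * (D * Q ^ 2) ≤ 2 * D * Q ^ 3 := by
        nlinarith [mul_nonneg (mul_nonneg hD0.le (sq_nonneg Q)) (sub_nonneg.2 hQ1)]
      have h5 : 2 * (1 + ρ ^ k) * (Q ^ 4 * (B - D)) =
          2 * Q ^ 4 * (B * (1 + Q⁻¹)) - 2 * Q ^ 4 * D - 2 * D * Q ^ 3 := by
        rw [eρ]
        field_simp
        ring
      have h6 : 2 * Q ^ 4 * (B * (1 + Q⁻¹)) ≤ 2 * Q ^ 4 * (B * Real.exp (ρ ^ k)) := by gcongr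
      calc _ ≤ 2 * (1 + ρ ^ k) * (Q ^ 4 * (B - D)) + 2 * D * Q ^ 3 :=
            add_le_add le_rfl (h3.trans h4)
        _ ≤ 2 * Q ^ 4 * (B * Real.exp (ρ ^ k)) - 2 * Q ^ 4 * D := by rw [h5]; linarith
        _ = _ := by ring
  have hsum : ∀ k, ∑ j ∈ range k, ρ ^ j ≤ (1 - ρ)⁻¹ := by
    intro k
    rw [← tsum_geometric_of_lt_one hρ0.le hρ1]
    exact (summable_geometric_of_lt_one hρ0.le hρ1).sum_le_tsum _ fun j _ => by positivity
  refine ⟨2 * ((4 + D) * Real.exp (1 - ρ)⁻¹), by positivity, fun T hT r hr => ?_⟩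
  obtain ⟨k, h1, h2⟩ := exists_two_pow T hT
  refine (key k r (hr.trans h1)).trans ?_
  have h2' : (2 : ℝ) ^ k ≤ 2 * T := by exact_mod_cast h2
  calc _ ≤ (2 : ℝ) ^ k * ((4 + D) * Real.exp (1 - ρ)⁻¹) := by
        gcongr
        refine (sub_le_self _ hD0.le).trans ?_
        gcongr
        exact hsum k
    _ ≤ (2 * T) * ((4 + D) * Real.exp (1 - ρ)⁻¹) := by gcongr
    _ = _ := by ring

/-- The summand of the corrector `ξ_n(T)` at time `k`, up to the factor `1 / T`. -/
noncomputable def cmp (d T : ℕ) (s : ℕ → V d) (k : ℕ) : ℝ :=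
  ∑ x ∈ rng 0 s k, esc d (↑(rng 0 s k)) x * GconvGT d T (x - pos 0 s k)

lemma xi_eq {d n T : ℕ} (s : ℕ → V d) : xi d n T s = (∑ k ∈ range (n + 1), cmp d T s k) / T := by
  rw [xi, Finset.sum_div]
  refine Finset.sum_congr rfl fun k _ => ?_
  rw [cmp, Finset.sum_div]
  refine Finset.sum_congr rfl fun x _ => ?_
  rw [mul_div_assoc]

lemma cmp_nonneg {d T : ℕ} (hd : 5 ≤ d) (s : ℕ → V d) (k : ℕ) : 0 ≤ cmp d T s k :=
  Finset.sum_nonneg fun _ _ => mul_nonneg (esc_nonneg _ _) (GconvGT_nonneg hd _ _)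

lemma cmp_join_le {d T N k : ℕ} (h : k ≤ N) (s t : ℕ → V d) :
    cmp d T (joinSteps N s t) k = cmp d T s k := by
  rw [cmp, rng_join_le h, pos_join_le 0 s t h, cmp]

lemma sum_cmp_join {d T j q : ℕ} (s t : ℕ → V d) :
    ∑ l ∈ range q, cmp d T (joinSteps (j + q * T) s t) (j + l * T) =
      ∑ l ∈ range q, cmp d T s (j + l * T) := by
  refine Finset.sum_congr rfl fun l hl => cmp_join_le ?_ s t
  rw [Finset.mem_range] at hl
  gcongr

lemma expN_exp_le {d n : ℕ} (hd : 0 < d) {Y : (ℕ → V d) → ℝ} (hY : ∀ s, |Y s| ≤ 1) :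
    expN d n (fun s => Real.exp (Y s)) ≤
      Real.exp (expN d n Y + expN d n (fun s => Y s ^ 2)) := by
  have h : ∀ s, Real.exp (Y s) ≤ 1 + (Y s + Y s ^ 2) := by
    intro s
    have := (abs_le.1 (Real.abs_exp_sub_one_sub_id_le (hY s))).2
    linarith
  refine (expN_mono h).trans ?_
  rw [expN_add, expN_add, expN_const hd, add_comm]
  exact Real.add_one_le_exp _

lemma expN_chiC_le {d r T : ℕ} (hd : 5 ≤ d) (hr : r ≤ T) (s : ℕ → V d) (N : ℕ) :
    expN d r (fun t => chiC (rng 0 s N) (rng (pos 0 s N) t r)) ≤ 2 * cmp d T s N := by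
  refine (expN_mono fun t => chiC_rng_le hd _ _ t).trans ?_
  simp only [expN_const_mul, expN_sum]
  rw [cmp]
  gcongr with y hy
  · exact esc_nonneg _ _
  · rw [GconvGT_eq hd]
    calc _ = ∑ j ∈ range (r + 1), tailG d j (y - pos 0 s N) := by
          refine Finset.sum_congr rfl fun j hj => ?_
          rw [Finset.mem_range] at hj
          have := expN_tailG_pos hd (a := r) (i := j) (by omega) 0 (y - pos 0 s N)
          rw [zero_add] at this
          rw [← this]
          congr 1
          funext t
          rw [G_eq_tailG, pos_eq_add, tailG_sub_comm]
          congr 1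
          abel
      _ ≤ _ := Finset.sum_le_sum_of_subset_of_nonneg (Finset.range_mono (by omega))
          fun _ _ _ => tailG_nonneg _

/-- One block of the exponential supermartingale. -/
lemma expN_block_le {d N r T : ℕ} (hd : 5 ≤ d) (hr : r ≤ T) {θ : ℝ} (hθ : 0 ≤ θ)
    (hθT : θ * (T + 1) ≤ 1) (a : ℝ) {F : (ℕ → V d) → ℝ}
    (hF : ∀ s t, F (joinSteps N s t) = F s) :
    expN d (N + r) (fun s => Real.exp (F s + θ * (expCapRange d r + a - cap (rng 0 s (N + r)))
        - 6 * θ * cmp d T s N)) ≤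
      Real.exp (2 * θ ^ 2 * varCap d r) *
        expN d N (fun s => Real.exp (F s + θ * (a - cap (rng 0 s N)))) := by
  have hd0 : 0 < d := by omega
  rw [expN_join, ← expN_const_mul]
  refine expN_mono fun s => ?_
  set χ : (ℕ → V d) → ℝ := fun t => chiC (rng 0 s N) (rng (pos 0 s N) t r) with hχ
  set μ := expCapRange d r with hμ
  set Y : (ℕ → V d) → ℝ := fun t => θ * (μ - (cap (rng 0 t r) - χ t)) with hYdef
  have e : ∀ t, F (joinSteps N s t) + θ * (μ + a - cap (rng 0 (joinSteps N s t) (N + r)))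
      - 6 * θ * cmp d T (joinSteps N s t) N =
      (F s + θ * (a - cap (rng 0 s N)) - 6 * θ * cmp d T s N) + Y t := by
    intro t
    rw [hF, cap_join, cmp_join_le le_rfl]
    simp only [hYdef, hχ]
    ring
  simp only [e, Real.exp_add _ (Y _), expN_const_mul]
  have hμ0 : 0 ≤ μ := expN_nonneg fun _ => cap_nonneg _
  have hμ1 : μ ≤ r + 1 := (expN_mono fun t => cap_rng_le 0 t).trans (expN_const hd0 _).le
  have hr' : (r : ℝ) ≤ T := by exact_mod_cast hr
  have hχ0 : ∀ t, 0 ≤ χ t := fun t => chiC_nonneg _ _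
  have hχ1 : ∀ t, χ t ≤ cap (rng 0 t r) := fun t =>
    (chiC_le_cap hd _ _).trans_eq (cap_rng_translate _ _)
  have hX : ∀ t : ℕ → V d, cap (rng 0 t r) ≤ r + 1 := fun t => cap_rng_le 0 t
  have hY : ∀ t, |Y t| ≤ 1 := by
    intro t
    have h1 := hχ0 t
    have h2 := hχ1 t
    have h3 := hX t
    have : |μ - (cap (rng 0 t r) - χ t)| ≤ T + 1 := by rw [abs_le]; constructor <;> linarith
    calc |Y t| = θ * |μ - (cap (rng 0 t r) - χ t)| := by
          simp only [hYdef, abs_mul, abs_of_nonneg hθ]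
      _ ≤ θ * (T + 1) := by gcongr
      _ ≤ 1 := hθT
  have hEY : expN d r Y = θ * expN d r χ := by
    have : ∀ t, Y t = θ * χ t - θ * (cap (rng 0 t r) - μ) := fun t => by
      simp only [hYdef]; ring
    rw [show Y = fun t => θ * χ t - θ * (cap (rng 0 t r) - μ) from funext this, expN_sub,
      expN_const_mul, expN_const_mul, expN_cap_sub hd0, mul_zero, sub_zero]
  have hEY2 : expN d r (fun t => Y t ^ 2) ≤ 2 * θ ^ 2 * varCap d r + 2 * θ * expN d r χ := by
    rw [varCap, ← expN_const_mul, ← expN_const_mul, ← expN_add]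
    refine expN_mono fun t => ?_
    have h1 := hχ0 t
    have h2 : θ * χ t ≤ 1 := by
      calc _ ≤ θ * (T + 1) := by
            gcongr
            exact (hχ1 t).trans ((hX t).trans (by linarith))
        _ ≤ 1 := hθT
    have h3 : θ * χ t * (θ * χ t) ≤ θ * χ t * 1 := by gcongr
    simp only [hYdef]
    nlinarith [sq_nonneg (θ * (cap (rng 0 t r) - μ) + θ * χ t)]
  have hEχ : expN d r χ ≤ 2 * cmp d T s N := expN_chiC_le hd hr s N
  rw [sub_eq_add_neg, Real.exp_add, mul_assoc, mul_comm (Real.exp (2 * θ ^ 2 * varCap d r))]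
  gcongr
  refine (mul_le_mul_of_nonneg_left (expN_exp_le hd0 hY) (Real.exp_pos _).le).trans ?_
  rw [← Real.exp_add]
  refine Real.exp_le_exp.2 ?_
  rw [hEY]
  nlinarith

lemma expN_exp_cap_le {d r T : ℕ} (hd : 5 ≤ d) (hr : r ≤ T) {θ : ℝ} (hθ : 0 ≤ θ)
    (hθT : θ * (T + 1) ≤ 1) :
    expN d r (fun s => Real.exp (θ * (expCapRange d r - cap (rng 0 s r)))) ≤
      Real.exp (2 * θ ^ 2 * varCap d r) := by
  have hd0 : 0 < d := by omega
  have hμ0 : 0 ≤ expCapRange d r := expN_nonneg fun _ => cap_nonneg _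
  have hμ1 : expCapRange d r ≤ r + 1 :=
    (expN_mono fun t => cap_rng_le 0 t).trans (expN_const hd0 _).le
  have hr' : (r : ℝ) ≤ T := by exact_mod_cast hr
  refine (expN_exp_le hd0 fun s => ?_).trans (Real.exp_le_exp.2 ?_)
  · have h1 := cap_nonneg (rng 0 s r)
    have h2 := cap_rng_le (n := r) 0 s
    have : |expCapRange d r - cap (rng 0 s r)| ≤ T + 1 := by rw [abs_le]; constructor <;> linarith
    rw [abs_mul, abs_of_nonneg hθ]
    exact (mul_le_mul_of_nonneg_left this hθ).trans hθT
  · have e1 : expN d r (fun s => θ * (expCapRange d r - cap (rng 0 s r))) = 0 := by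
      have : ∀ s : ℕ → V d, θ * (expCapRange d r - cap (rng 0 s r)) =
        (-θ) * (cap (rng 0 s r) - expCapRange d r) := fun s => by ring
      simp only [this, expN_const_mul, expN_cap_sub hd0, mul_zero]
    have e2 : expN d r (fun s => (θ * (expCapRange d r - cap (rng 0 s r))) ^ 2) =
        θ ^ 2 * varCap d r := by
      rw [varCap, ← expN_const_mul]
      congr 1
      funext s
      ring
    rw [e1, e2]
    nlinarith [mul_nonneg (sq_nonneg θ) (varCap_nonneg (d := d) (n := r))]

lemma expN_blocks_le {d j T : ℕ} (hd : 5 ≤ d) (hj : j ≤ T) {θ v : ℝ} (hθ : 0 ≤ θ)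
    (hθT : θ * (T + 1) ≤ 1) (hv : ∀ r ≤ T, varCap d r ≤ v) (q : ℕ) :
    expN d (j + q * T) (fun s => Real.exp (-(6 * θ * ∑ l ∈ range q, cmp d T s (j + l * T)) +
      θ * (expCapRange d j + q * expCapRange d T - cap (rng 0 s (j + q * T))))) ≤
      Real.exp (2 * θ ^ 2 * ((q + 1) * v)) := by
  induction q with
  | zero =>
    simp only [zero_mul, add_zero, Finset.sum_range_zero, mul_zero, neg_zero, zero_add,
      Nat.cast_zero, one_mul]
    refine (expN_exp_cap_le hd hj hθ hθT).trans ?_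
    gcongr
    exact hv j hj
  | succ q ih =>
    have h := expN_block_le (N := j + q * T) hd (le_refl T) hθ hθT
      (expCapRange d j + q * expCapRange d T)
      (F := fun s => -(6 * θ * ∑ l ∈ range q, cmp d T s (j + l * T))) (fun s t => by rw [sum_cmp_join])
    rw [show j + (q + 1) * T = j + q * T + T by ring]
    calc _ = _ := by
          congr 1
          funext s
          rw [Finset.sum_range_succ]
          congr 1
          push_cast
          ring
      _ ≤ _ := h
      _ ≤ Real.exp (2 * θ ^ 2 * v) * Real.exp (2 * θ ^ 2 * ((q + 1) * v)) := by
          gcongr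
          · exact expN_nonneg fun _ => (Real.exp_pos _).le
          · exact hv T le_rfl
      _ = _ := by
          rw [← Real.exp_add]
          push_cast
          ring_nf

lemma expCapRange_add_le {d : ℕ} (hd : 0 < d) (a b : ℕ) :
    expCapRange d (a + b) ≤ expCapRange d a + expCapRange d b := by
  have h : expCapRange d (a + b) = expN d (a + b) (fun s => cap (rng 0 s (a + b))) := rfl
  rw [h, expN_join]
  calc _ ≤ expN d a (fun s => expN d b (fun t => cap (rng 0 s a) + cap (rng 0 t b))) :=
        expN_mono fun s => expN_mono fun t => by
          rw [cap_join]
          linarith [chiC_nonneg (rng 0 s a) (rng (pos 0 s a) t b)]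
    _ = _ := by
        simp only [expN_add, expN_const hd]
        rfl

lemma expCapRange_blocks_le {d : ℕ} (hd : 0 < d) (j T q : ℕ) :
    expCapRange d (j + q * T) ≤ expCapRange d j + q * expCapRange d T := by
  induction q with
  | zero => simp
  | succ q ih =>
    rw [show j + (q + 1) * T = j + q * T + T by ring]
    have := expCapRange_add_le hd (j + q * T) T
    push_cast
    linarith

lemma sum_residues_le {T : ℕ} (hT : 1 ≤ T) (n : ℕ) {f : ℕ → ℝ} (hf : ∀ k, 0 ≤ f k)
    (h : T ≤ n) :
    ∑ j ∈ range T, ∑ l ∈ range ((n - j) / T + 1), f (j + l * T) ≤ ∑ k ∈ range (n + 1), f k := by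
  classical
  rw [← Finset.sum_fiberwise_of_maps_to (s := range (n + 1)) (t := range T) (g := fun k => k % T)
    fun k _ => Finset.mem_range.2 (Nat.mod_lt _ hT)]
  refine Finset.sum_le_sum fun j hj => ?_
  rw [Finset.mem_range] at hj
  rw [← Finset.sum_image (s := range ((n - j) / T + 1)) (g := fun l => j + l * T) (f := f)]
  · refine Finset.sum_le_sum_of_subset_of_nonneg ?_ fun _ _ _ => hf _
    intro k hk
    simp only [Finset.mem_image, Finset.mem_range, Finset.mem_filter] at hk ⊢
    obtain ⟨l, hl, rfl⟩ := hk
    have h1 : l * T ≤ n - j := (Nat.le_div_iff_mul_le hT).1 (by omega)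
    refine ⟨by omega, ?_⟩
    rw [Nat.add_mul_mod_self_right, Nat.mod_eq_of_lt hj]
  · intro x _ y _ hxy
    have : x * T = y * T := by simpa using hxy
    exact Nat.eq_of_mul_eq_mul_right hT this

/-- The exponential moment bound for the decomposition with a given offset. -/
lemma expN_offset_le {d n j T : ℕ} (hd : 5 ≤ d) (hT : 1 ≤ T) (hj : j ≤ T) (hjn : j ≤ n) {θ v : ℝ}
    (hθ : 0 ≤ θ) (hθT : θ * (T + 1) ≤ 1) (hv : ∀ r ≤ T, varCap d r ≤ v) :
    expN d n (fun s => Real.exp (θ * (expCapRange d n - cap (rng 0 s n) -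
      6 * ∑ l ∈ range ((n - j) / T + 1), cmp d T s (j + l * T)))) ≤
      Real.exp (2 * θ ^ 2 * (((n : ℝ) / T + 2) * v)) := by
  have hd0 : 0 < d := by omega
  set q := (n - j) / T with hq
  set r := (n - j) % T with hr
  have hn : n = j + q * T + r := by
    rw [add_assoc, Nat.div_add_mod' (n - j) T]
    omega
  have hrT : r ≤ T := (Nat.mod_lt _ hT).le
  have hμ : expCapRange d n ≤ expCapRange d r + (expCapRange d j + q * expCapRange d T) := by
    conv_lhs => rw [hn]
    have h1 := expCapRange_add_le hd0 (j + q * T) r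
    have h2 := expCapRange_blocks_le hd0 j T q
    linarith
  have hv0 : 0 ≤ v := varCap_nonneg.trans (hv 0 (Nat.zero_le _))
  have hqn : (q : ℝ) ≤ n / T := by
    rw [le_div_iff₀ (by exact_mod_cast hT)]
    exact_mod_cast (show q * T ≤ n from (Nat.div_mul_le_self (n - j) T).trans (Nat.sub_le n j))
  have h := expN_block_le (N := j + q * T) (r := r) hd hrT hθ hθT
      (expCapRange d j + q * expCapRange d T)
      (F := fun s => -(6 * θ * ∑ l ∈ range q, cmp d T s (j + l * T))) (fun s t => by rw [sum_cmp_join])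
  rw [← hn] at h
  calc _ ≤ _ := expN_mono fun s => by
        rw [Finset.sum_range_succ]
        have : θ * expCapRange d n ≤
            θ * (expCapRange d r + (expCapRange d j + q * expCapRange d T)) := by gcongr
        exact Real.exp_le_exp.2 (by linarith)
    _ ≤ _ := h
    _ ≤ Real.exp (2 * θ ^ 2 * v) * Real.exp (2 * θ ^ 2 * ((q + 1) * v)) := by
        gcongr
        · exact expN_nonneg fun _ => (Real.exp_pos _).le
        · exact hv r hrT
        · exact expN_blocks_le hd hj hθ hθT hv q
    _ ≤ _ := by
        rw [← Real.exp_add]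
        refine Real.exp_le_exp.2 ?_
        have : (q : ℝ) * v ≤ n / T * v := by gcongr
        have h2 : 2 * θ ^ 2 * (q * v) ≤ 2 * θ ^ 2 * (n / T * v) := by gcongr
        linarith

/-- The deviation bound in the regime where the block variances are under control. -/
lemma exists_deviation_le {d : ℕ} (hd : 5 ≤ d) {K : ℝ} (hK : 0 < K) :
    ∃ c : ℝ, 0 < c ∧ ∀ n T : ℕ, 1 ≤ T → T ≤ n → ∀ ζ v : ℝ, 0 < ζ →
      (∀ r ≤ T, varCap d r ≤ v) → ((n : ℝ) / T + 2) * v ≤ K * (ζ * T) →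
      probN d n (fun s => cap (rng 0 s n) - expCapRange d n ≤ -ζ ∧ xi d n T s < c * ζ) ≤
        T * Real.exp (-c * ζ / T) := by
  classical
  have hd0 : 0 < d := by omega
  set c₁ : ℝ := min (1 / 3) (1 / (8 * K)) with hc₁
  have hc0 : 0 < c₁ := by positivity
  have hc3 : c₁ ≤ 1 / 3 := min_le_left _ _
  have hcK : c₁ * K ≤ 1 / 8 := by
    calc c₁ * K ≤ 1 / (8 * K) * K := by gcongr; exact min_le_right _ _
      _ = 1 / 8 := by field_simp
  refine ⟨c₁ / 4, by positivity, fun n T hT hTn ζ v hζ hv hvK => ?_⟩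
  have hT0 : (0 : ℝ) < T := by exact_mod_cast hT
  have hT1 : (1 : ℝ) ≤ T := by exact_mod_cast hT
  set θ : ℝ := c₁ / T with hθ
  have hθ0 : 0 < θ := by positivity
  have hθT : θ * (T + 1) ≤ 1 := by
    rw [hθ, div_mul_eq_mul_div, div_le_one hT0]
    nlinarith
  set Y : ℕ → (ℕ → V d) → ℝ := fun j s => expCapRange d n - cap (rng 0 s n) -
      6 * ∑ l ∈ range ((n - j) / T + 1), cmp d T s (j + l * T) with hY
  have hpt : ∀ s : ℕ → V d, (if cap (rng 0 s n) - expCapRange d n ≤ -ζ ∧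
      xi d n T s < c₁ / 4 * ζ then (1 : ℝ) else 0) ≤
      ∑ j ∈ range T, Real.exp (-(θ * ζ / 2)) * Real.exp (θ * Y j s) := by
    intro s
    split_ifs with h
    · obtain ⟨h1, h2⟩ := h
      rw [xi_eq, div_lt_iff₀ hT0] at h2
      have h3 := sum_residues_le hT n (cmp_nonneg (T := T) hd s) hTn
      have hsum : (T : ℝ) * (ζ / 2) ≤ ∑ j ∈ range T, Y j s := by
        simp only [hY, Finset.sum_sub_distrib, ← Finset.mul_sum, Finset.sum_const,
          Finset.card_range, nsmul_eq_mul]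
        have h4 : (T : ℝ) * ζ ≤ T * (expCapRange d n - cap (rng 0 s n)) := by
          gcongr
          linarith
        have h5 : c₁ / 4 * ζ * T ≤ 1 / 12 * ζ * T :=
          mul_le_mul_of_nonneg_right (mul_le_mul_of_nonneg_right (by linarith) hζ.le) hT0.le
        linarith
      obtain ⟨j, hj, hjY⟩ : ∃ j ∈ range T, ζ / 2 ≤ Y j s := by
        by_contra! hcon
        have := Finset.sum_lt_sum_of_nonempty (Finset.nonempty_range_iff.2 (by omega)) hcon
        rw [Finset.sum_const, Finset.card_range, nsmul_eq_mul] at this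
        linarith
      refine le_trans ?_ (Finset.single_le_sum (f := fun j =>
        Real.exp (-(θ * ζ / 2)) * Real.exp (θ * Y j s)) (fun j _ => by positivity) hj)
      rw [← Real.exp_add]
      refine Real.one_le_exp ?_
      have := mul_le_mul_of_nonneg_left hjY hθ0.le
      linarith
    · exact Finset.sum_nonneg fun j _ => by positivity
  rw [probN_eq]
  refine (expN_mono fun s => (hpt s).trans_eq' (by congr)).trans ?_
  rw [expN_sum]
  calc _ ≤ ∑ j ∈ range T, Real.exp (-(θ * ζ / 2)) *
        Real.exp (2 * θ ^ 2 * (((n : ℝ) / T + 2) * v)) := by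
        refine Finset.sum_le_sum fun j hj => ?_
        rw [Finset.mem_range] at hj
        rw [expN_const_mul]
        gcongr
        exact expN_offset_le hd hT hj.le (by omega) hθ0.le hθT hv
    _ ≤ ∑ j ∈ range T, Real.exp (-(c₁ / 4) * ζ / T) := by
        refine Finset.sum_le_sum fun j hj => ?_
        rw [← Real.exp_add]
        refine Real.exp_le_exp.2 ?_
        have h1 : 2 * θ ^ 2 * (((n : ℝ) / T + 2) * v) ≤ 2 * θ ^ 2 * (K * (ζ * T)) := by gcongr
        have h2 : 2 * θ ^ 2 * (K * (ζ * T)) = 2 * (c₁ * K) * (c₁ * ζ / T) := by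
          rw [hθ]; field_simp
        have h3 : 0 ≤ c₁ * ζ / T := by positivity
        have h4 : θ * ζ = c₁ * ζ / T := by rw [hθ]; ring
        have h5 : -(c₁ / 4) * ζ / T = -(1 / 4) * (c₁ * ζ / T) := by ring
        rw [h4, h5]
        nlinarith
    _ = _ := by rw [Finset.sum_const, Finset.card_range, nsmul_eq_mul]

lemma expN_sum_sq {d : ℕ} (hd : 0 < d) (n : ℕ) (x : V d) :
    expN d n (fun s => ∑ i, ((pos x s n i : ℤ) : ℝ) ^ 2) = ∑ i, ((x i : ℤ) : ℝ) ^ 2 + n := by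
  induction n generalizing x with
  | zero => simp [expN_zero, pos_zero]
  | succ n ih =>
    have hd' : ((2 * d : ℕ) : ℝ) ≠ 0 := by positivity
    have key : ∀ (i : Fin d) (a : ℤ), ∑ j, (((x + Pi.single i a : V d) j : ℤ) : ℝ) ^ 2 =
        ∑ j, ((x j : ℤ) : ℝ) ^ 2 + (2 * a * x i + a ^ 2) := by
      intro i a
      have : ∀ j, (((x + Pi.single i a : V d) j : ℤ) : ℝ) ^ 2 =
          ((x j : ℤ) : ℝ) ^ 2 + if j = i then 2 * (a : ℝ) * x i + (a : ℝ) ^ 2 else 0 := by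
        intro j
        by_cases h : j = i
        · subst h
          simp
          ring
        · simp [h]
      simp only [this, Finset.sum_add_distrib]
      simp
    rw [expN_succ]
    simp only [pos_cons, ih]
    rw [sum_steps (fun e => ∑ i, (((x + e : V d) i : ℤ) : ℝ) ^ 2 + (n : ℝ)), div_eq_iff hd']
    simp only [key]
    push_cast
    have : ∀ i : Fin d, (∑ j, ((x j : ℤ) : ℝ) ^ 2 + (2 * 1 * (x i : ℝ) + 1 ^ 2) + (n : ℝ) +
        (∑ j, ((x j : ℤ) : ℝ) ^ 2 + (2 * -1 * (x i : ℝ) + (-1) ^ 2) + (n : ℝ))) =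
        2 * (∑ j, ((x j : ℤ) : ℝ) ^ 2 + (n + 1)) := fun i => by ring
    simp only [this, Finset.sum_const, Finset.card_univ, Fintype.card_fin, nsmul_eq_mul]
    ring

lemma sum_sq_hk_le {d : ℕ} (B : Finset (V d)) (m : ℕ) :
    ∑ x ∈ B, hk d m x ^ 2 ≤ hk d (2 * m) 0 := by
  classical
  have h := expN_hk_add (d := d) (a := m) (n := m) 0
  simp only [zero_add] at h
  rw [two_mul, ← h]
  calc ∑ x ∈ B, hk d m x ^ 2 =
      expN d m (fun s => ∑ x ∈ B, (if pos 0 s m = x then 1 else 0) * hk d m x) := by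
        simp only [expN_sum, expN_mul_const, ← hk_eq, sq]
    _ ≤ _ := expN_mono fun s => by
        simp only [ite_mul, one_mul, zero_mul, Finset.sum_ite_eq]
        split_ifs
        · exact le_rfl
        · exact hk_nonneg _

/-- On-diagonal lower bound for the heat kernel. -/
lemma le_hk_two_mul {d m r : ℕ} (hd : 0 < d) (h : 2 * m ≤ (r + 1) ^ 2) :
    1 / 4 ≤ (2 * (r : ℝ) + 1) ^ d * hk d (2 * m) 0 := by
  classical
  set B : Finset (V d) := Fintype.piFinset fun _ => Finset.Icc (-(r : ℤ)) r with hB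
  have hcard : (B.card : ℝ) = (2 * (r : ℝ) + 1) ^ d := by
    rw [hB, Fintype.card_piFinset]
    simp only [Int.card_Icc, Finset.prod_const, Finset.card_univ, Fintype.card_fin]
    have : ((r : ℤ) + 1 - -(r : ℤ)).toNat = 2 * r + 1 := by omega
    rw [this]
    push_cast
    ring
  have hr : (0 : ℝ) < ((r : ℝ) + 1) ^ 2 := by positivity
  have hm : (2 * m : ℝ) ≤ ((r : ℝ) + 1) ^ 2 := by exact_mod_cast h
  have hhalf : 1 / 2 ≤ ∑ x ∈ B, hk d m x := by
    have e : ∑ x ∈ B, hk d m x = expN d m (fun s => if pos 0 s m ∈ B then 1 else 0) := by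
      simp only [hk_eq, ← expN_sum, Finset.sum_ite_eq]
    rw [e]
    calc (1 : ℝ) / 2 ≤ 1 - ((r : ℝ) + 1) ^ (2 : ℕ) / 2 / ((r : ℝ) + 1) ^ 2 := by
          rw [div_right_comm, div_self hr.ne']; norm_num
      _ ≤ 1 - (m : ℝ) / ((r : ℝ) + 1) ^ 2 := by gcongr; linarith
      _ = expN d m (fun s => 1 - (∑ i, ((pos 0 s m i : ℤ) : ℝ) ^ 2) * (((r : ℝ) + 1) ^ 2)⁻¹) := by
          rw [expN_sub, expN_const hd, expN_mul_const, expN_sum_sq hd]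
          simp [div_eq_mul_inv]
      _ ≤ _ := expN_mono fun s => by
          have h0 : 0 ≤ (∑ i, ((pos 0 s m i : ℤ) : ℝ) ^ 2) * (((r : ℝ) + 1) ^ 2)⁻¹ := by positivity
          split_ifs with hs
          · linarith
          · rw [sub_nonpos, ← div_eq_mul_inv, one_le_div hr]
            simp only [hB, Fintype.mem_piFinset, Finset.mem_Icc, not_forall, not_and_or,
              not_le] at hs
            obtain ⟨i, hi⟩ := hs
            have h1 : ((r : ℤ) + 1) ^ 2 ≤ (pos 0 s m i) ^ 2 := by
              rcases hi with hi | hi <;> nlinarith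
            have h2 : ((r : ℝ) + 1) ^ 2 ≤ ((pos 0 s m i : ℤ) : ℝ) ^ 2 := by exact_mod_cast h1
            exact h2.trans (Finset.single_le_sum
              (f := fun i => ((pos 0 s m i : ℤ) : ℝ) ^ 2) (fun _ _ => sq_nonneg _)
              (Finset.mem_univ i))
  have hcs := sq_sum_le_card_mul_sum_sq (s := B) (f := fun x => hk d m x)
  rw [hcard] at hcs
  calc (1 : ℝ) / 4 = (1 / 2) ^ 2 := by norm_num
    _ ≤ (∑ x ∈ B, hk d m x) ^ 2 := by gcongr
    _ ≤ _ := hcs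
    _ ≤ _ := by gcongr; exact sum_sq_hk_le B m

lemma expN_GconvGT_pos {d T a i : ℕ} (hd : 5 ≤ d) (h : i ≤ a) (w : V d) :
    expN d a (fun s => GconvGT d T (pos 0 s i + w)) = ∑ t ∈ range (T + 1), tailG d (t + i) w := by
  simp only [GconvGT_eq hd, expN_sum]
  refine Finset.sum_congr rfl fun t _ => ?_
  have := expN_tailG_pos hd h t (-w)
  simpa only [sub_neg_eq_add, tailG_neg] using this

lemma sqrt_le_sum_expN_GconvGT {T : ℕ} (hT : 1 ≤ T) :
    1 / 12500 * Real.sqrt T ≤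
      ∑ i ∈ range (T + 1), expN 5 T (fun s => GconvGT 5 T (pos 0 s i)) := by
  classical
  set r := Nat.sqrt (4 * T) with hr
  set u := Real.sqrt T with hu
  have hT1 : (1 : ℝ) ≤ T := by exact_mod_cast hT
  have hu2 : u ^ 2 = T := Real.sq_sqrt (by positivity)
  have hu1 : 1 ≤ u := Real.one_le_sqrt.2 hT1
  have hr1 : 4 * T ≤ (r + 1) ^ 2 := (Nat.lt_succ_sqrt' (4 * T)).le
  have hr2 : (r : ℝ) ≤ 2 * u := by
    have : (r : ℝ) ^ 2 ≤ 4 * T := by exact_mod_cast Nat.sqrt_le' (4 * T)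
    nlinarith
  have hx : 2 * (r : ℝ) + 1 ≤ 5 * u := by linarith
  have hhk : ∀ m ≤ 2 * T, 1 / (4 * (5 * u) ^ 5) ≤ hk 5 (2 * m) 0 := by
    intro m hm
    have h1 := le_hk_two_mul (d := 5) (m := m) (r := r) (by norm_num) (by omega)
    have h2 : (2 * (r : ℝ) + 1) ^ 5 * hk 5 (2 * m) 0 ≤ (5 * u) ^ 5 * hk 5 (2 * m) 0 := by
      gcongr
      exact hk_nonneg _
    rw [div_le_iff₀ (by positivity)]
    linarith
  have htail : ((T : ℝ) + 1) * (1 / (4 * (5 * u) ^ 5)) ≤ tailG 5 (2 * T) 0 := by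
    have h1 := (summable_hk (d := 5) le_rfl (2 * T) 0).sum_le_tsum
      ((range (T + 1)).image fun i => 2 * i) (fun _ _ => hk_nonneg _)
    rw [Finset.sum_image (fun x _ y _ h => by simpa using h)] at h1
    refine le_trans ?_ h1
    calc _ = ∑ i ∈ range (T + 1), 1 / (4 * (5 * u) ^ 5) := by
          rw [Finset.sum_const, Finset.card_range, nsmul_eq_mul]; push_cast; ring
      _ ≤ _ := Finset.sum_le_sum fun i hi => by
          rw [Finset.mem_range] at hi
          rw [← mul_add]
          exact hhk _ (by omega)
  calc 1 / 12500 * u = u ^ 2 * (u ^ 2 * (u ^ 2 * (1 / (4 * (5 * u) ^ 5)))) := by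
        field_simp
        norm_num
    _ ≤ ((T : ℝ) + 1) * (((T : ℝ) + 1) * (((T : ℝ) + 1) * (1 / (4 * (5 * u) ^ 5)))) := by
        rw [hu2]
        gcongr <;> linarith
    _ ≤ ((T : ℝ) + 1) * (((T : ℝ) + 1) * tailG 5 (2 * T) 0) := by gcongr
    _ = ∑ i ∈ range (T + 1), ∑ t ∈ range (T + 1), tailG 5 (2 * T) 0 := by
        simp only [Finset.sum_const, Finset.card_range, nsmul_eq_mul]
        push_cast
        ring
    _ ≤ _ := Finset.sum_le_sum fun i hi => by
        rw [Finset.mem_range] at hi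
        have := expN_GconvGT_pos (T := T) (a := T) (i := i) (d := 5) le_rfl (by omega) 0
        simp only [add_zero] at this
        rw [this]
        refine Finset.sum_le_sum fun t ht => ?_
        rw [Finset.mem_range] at ht
        exact tailG_antitone le_rfl 0 (by omega)

lemma exists_expN_GconvGT_mul_le {d : ℕ} (hd : 5 ≤ d) :
    ∃ C : ℝ, 0 < C ∧ ∀ T : ℕ, 1 ≤ T →
      ∑ i ∈ range (T + 1), ∑ i' ∈ range (T + 1),
        expN d T (fun s => GconvGT d T (pos 0 s i) * G d (pos 0 s i - pos 0 s i')) ≤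
      C * Real.sqrt T := by
  have hd0 : 0 < d := by omega
  have h5 : (5 : ℝ) ≤ d := by exact_mod_cast hd
  obtain ⟨C, hC, hG⟩ := exists_tailG_le (d := d) (γ := 3 / 2) hd0 (by norm_num) (by linarith)
  set D : ℝ := 2 ^ ((1 : ℝ) / 2 + 1) / (1 / 2) with hD
  have hD0 : 0 < D := by positivity
  set v : ℕ → ℝ := fun p => ((p : ℝ) + 1) ^ (-(3 / 2) : ℝ) with hv
  set w : ℕ → ℝ := fun p => ((p : ℝ) + 1) ^ (-(1 / 2) : ℝ) with hw
  have hv0 : ∀ p, 0 ≤ v p := fun p => by positivity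
  have hw0 : ∀ p, 0 ≤ w p := fun p => by positivity
  have hvsum : ∀ b N : ℕ, ∑ n ∈ range N, v (n + b) ≤ D * w b := by
    intro b N
    have := sum_rpow_le (γ := 1 / 2) (by norm_num) b N
    rw [show (-((1 : ℝ) / 2 + 1)) = -(3 / 2) by norm_num] at this
    exact this
  have hg : ∀ T i z, ∑ t ∈ range (T + 1), tailG d (t + i) z ≤ C * D * w i := by
    intro T i z
    calc _ ≤ ∑ t ∈ range (T + 1), C * v (t + i) := Finset.sum_le_sum fun t _ => hG _ _
      _ ≤ _ := by
        rw [← Finset.mul_sum, mul_assoc]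
        gcongr
        exact hvsum i (T + 1)
  have hpair : ∀ T i i', i ≤ T → i' ≤ T →
      expN d T (fun s => GconvGT d T (pos 0 s i) * G d (pos 0 s i - pos 0 s i')) ≤
        C ^ 2 * D * (v (max i i' - min i i') * w (min i i')) := by
    intro T i i' hi hi'
    rcases le_total i i' with h | h
    · obtain ⟨k, rfl⟩ := Nat.exists_eq_add_of_le h
      rw [expN_of_local hd0 (fun s t => by rw [pos_join_le 0 s t h, pos_join_le 0 s t le_rfl]) hi',
        expN_join]
      have e : ∀ s t : ℕ → V d, GconvGT d T (pos 0 (joinSteps i s t) i) *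
          G d (pos 0 (joinSteps i s t) i - pos 0 (joinSteps i s t) (i + k)) =
          GconvGT d T (pos 0 s i) * tailG d 0 (pos 0 t k - 0) := by
        intro s t
        rw [pos_join_le 0 s t le_rfl, pos_join_add, pos_eq_add (pos 0 s i) t k, G_eq_tailG,
          tailG_sub_comm, add_sub_cancel_left, sub_zero]
      simp only [e, expN_const_mul, expN_mul_const, expN_tailG_pos hd le_rfl]
      have h1 := expN_GconvGT_pos (T := T) hd (le_refl i) 0
      simp only [add_zero] at h1
      rw [h1, max_eq_right h, min_eq_left h, Nat.add_sub_cancel_left, zero_add]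
      calc _ ≤ (C * D * w i) * (C * v k) := by
            gcongr
            · exact tailG_nonneg _
            · exact hg T i 0
            · exact hG k 0
        _ = _ := by ring
    · obtain ⟨k, rfl⟩ := Nat.exists_eq_add_of_le h
      rw [expN_of_local hd0 (fun s t => by rw [pos_join_le 0 s t h, pos_join_le 0 s t le_rfl]) hi,
        expN_join]
      have e : ∀ s t : ℕ → V d, GconvGT d T (pos 0 (joinSteps i' s t) (i' + k)) *
          G d (pos 0 (joinSteps i' s t) (i' + k) - pos 0 (joinSteps i' s t) i') =
          GconvGT d T (pos 0 s i' + pos 0 t k) * tailG d 0 (pos 0 t k - 0) := by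
        intro s t
        rw [pos_join_le 0 s t le_rfl, pos_join_add, pos_eq_add (pos 0 s i') t k, G_eq_tailG,
          add_sub_cancel_left, sub_zero]
      simp only [e]
      rw [expN_comm]
      simp only [expN_mul_const, expN_GconvGT_pos hd le_rfl]
      rw [max_eq_left h, min_eq_right h, Nat.add_sub_cancel_left]
      calc _ ≤ expN d k (fun t => (C * D * w i') * tailG d 0 (pos 0 t k - 0)) :=
            expN_mono fun t => by
              gcongr
              · exact tailG_nonneg _
              · exact hg T i' _
        _ = C * D * w i' * tailG d k 0 := by
            rw [expN_const_mul, expN_tailG_pos hd le_rfl, zero_add]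
        _ ≤ C * D * w i' * (C * v k) := by
            gcongr
            exact hG k 0
        _ = _ := by ring
  refine ⟨C ^ 2 * D * (2 * (D * 4)), by positivity, fun T hT => ?_⟩
  have hT1 : (1 : ℝ) ≤ T := by exact_mod_cast hT
  calc _ ≤ ∑ i ∈ range (T + 1), ∑ i' ∈ range (T + 1),
        C ^ 2 * D * (v (max i i' - min i i') * w (min i i')) := by
        refine Finset.sum_le_sum fun i hi => Finset.sum_le_sum fun i' hi' => ?_
        rw [Finset.mem_range] at hi hi'
        exact hpair T i i' (by omega) (by omega)
    _ = C ^ 2 * D * ∑ i ∈ range (T + 1), ∑ i' ∈ range (T + 1),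
        v (max i i' - min i i') * w (min i i') := by simp only [← Finset.mul_sum]
    _ ≤ C ^ 2 * D * (2 * ((∑ p ∈ range (T + 1), v p) * ∑ p ∈ range (T + 1), w p)) := by
        gcongr
        exact sum_sum_le_two_mul v w hv0 hw0 _
    _ ≤ C ^ 2 * D * (2 * (D * (4 * Real.sqrt T))) := by
        have h1 : ∑ p ∈ range (T + 1), v p ≤ D := by
          have := hvsum 0 (T + 1)
          simpa [hw] using this
        have h2 : ∑ p ∈ range (T + 1), w p ≤ 4 * Real.sqrt T := by
          have := sum_rpow_neg_le (δ := 1 / 2) (by norm_num) (by norm_num) (T + 1)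
          rw [show 1 / (1 - (1 : ℝ) / 2) = 2 by norm_num, show 1 - (1 : ℝ) / 2 = 1 / 2 by norm_num,
            ← Real.sqrt_eq_rpow] at this
          refine this.trans ?_
          have h3 : Real.sqrt ((T + 1 : ℕ) : ℝ) ≤ 2 * Real.sqrt T := by
            rw [Real.sqrt_le_left (by positivity), mul_pow, Real.sq_sqrt (by positivity)]
            push_cast
            linarith
          linarith
        have h0 : 0 ≤ ∑ p ∈ range (T + 1), w p := Finset.sum_nonneg fun p _ => hw0 p
        gcongr
    _ = _ := by ring

lemma sum_esc_mul_GconvGT {d T : ℕ} (hd : 5 ≤ d) (A : Finset (V d)) (z : V d) :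
    ∑ x ∈ A, esc d (↑A) x * GconvGT d T (x - z) =
      ∑ t ∈ range (T + 1), expN d t (fun u => pot A (z + pos 0 u t)) := by
  simp only [pot, expN_sum, expN_const_mul, GconvGT_eq hd, Finset.mul_sum]
  rw [Finset.sum_comm]
  refine Finset.sum_congr rfl fun t _ => Finset.sum_congr rfl fun x _ => ?_
  congr 1
  have := expN_tailG_sub hd t 0 (x - z)
  rw [zero_add] at this
  rw [← this]
  congr 1
  funext u
  rw [G_eq_tailG, tailG_sub_comm]
  congr 1
  abel

lemma cmp_le {d T : ℕ} (hd : 5 ≤ d) (s : ℕ → V d) (k : ℕ) : cmp d T s k ≤ T + 1 := by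
  rw [cmp, sum_esc_mul_GconvGT hd]
  calc _ ≤ ∑ t ∈ range (T + 1), (1 : ℝ) := Finset.sum_le_sum fun t _ =>
        (expN_mono fun _ => pot_le_one hd _ _).trans (expN_const (by omega) 1).le
    _ = _ := by simp

lemma sum_GconvGT_le {d T : ℕ} (hd : 5 ≤ d) {ι : Type*} (I : Finset ι) (y : ι → V d)
    {A : Finset (V d)} {K : ℝ} (hK : 0 ≤ K) (hA : ∀ i ∈ I, y i ∈ A)
    (h : ∀ i ∈ I, ∑ j ∈ I, G d (y i - y j) ≤ K) (z : V d) :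
    ∑ i ∈ I, GconvGT d T (y i - z) ≤ K * ∑ x ∈ A, esc d (↑A) x * GconvGT d T (x - z) := by
  rw [sum_esc_mul_GconvGT hd, Finset.mul_sum]
  simp only [GconvGT_eq hd]
  rw [Finset.sum_comm]
  refine Finset.sum_le_sum fun t _ => ?_
  rw [← expN_const_mul]
  refine le_trans (le_of_eq ?_) (expN_mono fun u => sum_G_le_pot hd I y hK hA h _)
  rw [expN_sum]
  refine Finset.sum_congr rfl fun i _ => ?_
  have := expN_tailG_sub hd t 0 (y i - z)
  rw [zero_add] at this
  rw [← this]
  congr 1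
  funext u
  rw [G_eq_tailG, tailG_sub_comm]
  congr 1
  abel

/-- The Green energy between the end point of a block and the points of the block whose own
energy is at most `K`. -/
noncomputable def goodEnergy (d T : ℕ) (K : ℝ) (t : ℕ → V d) : ℝ :=
  ∑ i ∈ range (T + 1) with ∑ j ∈ range (T + 1), G d (pos 0 t i - pos 0 t j) ≤ K,
    GconvGT d T (pos 0 t i - pos 0 t T)

lemma goodEnergy_le_cmp {d T : ℕ} (hd : 5 ≤ d) {K : ℝ} (hK : 0 ≤ K) (N : ℕ) (s t : ℕ → V d) :
    goodEnergy d T K t ≤ K * cmp d T (joinSteps N s t) (N + T) := by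
  have e : ∀ i, pos 0 (joinSteps N s t) (N + i) = pos 0 s N + pos 0 t i := fun i => by
    rw [pos_join_add, pos_eq_add]
  refine le_trans (le_of_eq ?_) (sum_GconvGT_le hd
    ((range (T + 1)).filter fun i => ∑ j ∈ range (T + 1), G d (pos 0 t i - pos 0 t j) ≤ K)
    (fun i => pos 0 (joinSteps N s t) (N + i)) hK ?_ ?_ _)
  · refine Finset.sum_congr rfl fun i _ => ?_
    rw [e, e, add_sub_add_left_eq_sub]
  · intro i hi
    rw [Finset.mem_filter, Finset.mem_range] at hi
    exact mem_rng.2 ⟨N + i, by omega, rfl⟩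
  · intro i hi
    rw [Finset.mem_filter] at hi
    simp only [e, add_sub_add_left_eq_sub]
    exact (Finset.sum_le_sum_of_subset_of_nonneg (Finset.filter_subset _ _)
      fun _ _ _ => G_nonneg _).trans hi.2

lemma exists_sqrt_le_expN_goodEnergy :
    ∃ K : ℝ, 0 < K ∧ ∀ T : ℕ, 1 ≤ T →
      1 / 25000 * Real.sqrt T ≤ expN 5 T (goodEnergy 5 T K) := by
  obtain ⟨C, hC, hCb⟩ := exists_expN_GconvGT_mul_le (d := 5) le_rfl
  refine ⟨25000 * C, by positivity, fun T hT => ?_⟩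
  set K := 25000 * C with hK
  have hK0 : 0 < K := by positivity
  have hrev : ∀ t : ℕ → V 5, ∑ i ∈ range (T + 1), (GconvGT 5 T (pos 0 t i) -
      (∑ j ∈ range (T + 1), GconvGT 5 T (pos 0 t i) * G 5 (pos 0 t i - pos 0 t j)) / K) ≤
      goodEnergy 5 T K (revSteps T t) := by
    intro t
    rw [goodEnergy, Finset.sum_filter, ← Finset.sum_flip]
    refine Finset.sum_le_sum fun i hi => ?_
    rw [Finset.mem_range] at hi
    have e1 : ∑ j ∈ range (T + 1), G 5 (pos 0 (revSteps T t) i - pos 0 (revSteps T t) j) =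
        ∑ j ∈ range (T + 1), G 5 (pos 0 t (T - i) - pos 0 t j) := by
      rw [← Finset.sum_flip (f := fun j => G 5 (pos 0 t (T - i) - pos 0 t j))]
      refine Finset.sum_congr rfl fun j hj => ?_
      rw [Finset.mem_range] at hj
      rw [pos_rev t (by omega), pos_rev t (by omega), sub_sub_sub_cancel_left, G_sub_comm]
    have e2 : pos 0 (revSteps T t) i - pos 0 (revSteps T t) T = -pos 0 t (T - i) := by
      rw [pos_rev t (by omega), pos_rev t le_rfl, Nat.sub_self, pos_zero]
      abel
    rw [e1, e2, GconvGT_neg le_rfl, ← Finset.mul_sum]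
    have h0 := GconvGT_nonneg (d := 5) le_rfl T (pos 0 t (T - i))
    have h1 : 0 ≤ ∑ j ∈ range (T + 1), G 5 (pos 0 t (T - i) - pos 0 t j) :=
      Finset.sum_nonneg fun _ _ => G_nonneg _
    split_ifs with h
    · have := div_nonneg (mul_nonneg h0 h1) hK0.le
      linarith
    · rw [sub_nonpos, le_div_iff₀ hK0]
      gcongr
      exact (not_le.1 h).le
  rw [expN_rev]
  refine le_trans ?_ (expN_mono hrev)
  have h1 := sqrt_le_sum_expN_GconvGT hT
  have h2 := hCb T hT
  simp only [div_eq_mul_inv _ K, expN_sum, expN_sub, expN_mul_const, Finset.sum_sub_distrib,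
    ← Finset.sum_mul]
  rw [← div_eq_mul_inv]
  have h3 : (∑ i ∈ range (T + 1), ∑ j ∈ range (T + 1), expN 5 T
      (fun t => GconvGT 5 T (pos 0 t i) * G 5 (pos 0 t i - pos 0 t j))) / K ≤
      1 / 25000 * Real.sqrt T := by
    rw [div_le_iff₀ hK0]
    refine h2.trans (le_of_eq ?_)
    rw [hK]
    ring
  linarith

lemma expN_exp_neg_cmp_le {d T : ℕ} (hd : 5 ≤ d) {K m θ : ℝ} (hK : 0 < K)
    (hm : m ≤ expN d T (goodEnergy d T K)) (hθ : 0 ≤ θ) (hθT : θ * (T + 1) ≤ 1 / 2) (j q : ℕ) :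
    expN d (j + q * T) (fun s => Real.exp (-(θ * ∑ l ∈ range q, cmp d T s (j + (l + 1) * T)))) ≤
      Real.exp (-(θ * m / (2 * K)) * q) := by
  have hd0 : 0 < d := by omega
  induction q with
  | zero => simp [expN_const hd0]
  | succ q ih =>
    have hpt : ∀ s t : ℕ → V d, Real.exp (-(θ * ∑ l ∈ range (q + 1),
        cmp d T (joinSteps (j + q * T) s t) (j + (l + 1) * T))) ≤
        Real.exp (-(θ * ∑ l ∈ range q, cmp d T s (j + (l + 1) * T))) *
          (1 - θ / (2 * K) * goodEnergy d T K t) := by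
      intro s t
      have e1 : ∑ l ∈ range q, cmp d T (joinSteps (j + q * T) s t) (j + (l + 1) * T) =
          ∑ l ∈ range q, cmp d T s (j + (l + 1) * T) := by
        refine Finset.sum_congr rfl fun l hl => cmp_join_le ?_ s t
        rw [Finset.mem_range] at hl
        have : (l + 1) * T ≤ q * T := Nat.mul_le_mul_right T hl
        omega
      have h1 := goodEnergy_le_cmp (T := T) hd hK.le (j + q * T) s t
      have h2 := cmp_le (T := T) hd (joinSteps (j + q * T) s t) (j + q * T + T)
      have h0 := cmp_nonneg (T := T) hd (joinSteps (j + q * T) s t) (j + q * T + T)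
      rw [Finset.sum_range_succ, e1, show j + (q + 1) * T = j + q * T + T by ring, mul_add,
        neg_add, Real.exp_add]
      gcongr
      set c := cmp d T (joinSteps (j + q * T) s t) (j + q * T + T)
      have h3 : θ * c ≤ 1 / 2 := (mul_le_mul_of_nonneg_left h2 hθ).trans hθT
      have h4 : 0 ≤ θ * c := mul_nonneg hθ h0
      have h5 := (abs_le.1 (Real.abs_exp_sub_one_sub_id_le (x := -(θ * c))
        (by rw [abs_neg, abs_of_nonneg h4]; linarith))).2
      have h6 : θ / (2 * K) * goodEnergy d T K t ≤ θ * c / 2 := by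
        calc _ ≤ θ / (2 * K) * (K * c) := by gcongr
          _ = _ := by field_simp
      nlinarith
    rw [show j + (q + 1) * T = j + q * T + T by ring, expN_join]
    calc _ ≤ expN d (j + q * T) (fun s => expN d T (fun t =>
          Real.exp (-(θ * ∑ l ∈ range q, cmp d T s (j + (l + 1) * T))) *
            (1 - θ / (2 * K) * goodEnergy d T K t))) := expN_mono fun s => expN_mono fun t => hpt s t
      _ = expN d (j + q * T) (fun s =>
          Real.exp (-(θ * ∑ l ∈ range q, cmp d T s (j + (l + 1) * T)))) *
            (1 - θ / (2 * K) * expN d T (goodEnergy d T K)) := by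
          simp only [expN_const_mul, expN_sub, expN_const hd0, expN_mul_const]
      _ ≤ Real.exp (-(θ * m / (2 * K)) * q) * Real.exp (-(θ * m / (2 * K))) := by
          have h1 : θ / (2 * K) * m ≤ θ / (2 * K) * expN d T (goodEnergy d T K) := by gcongr
          have h2 := Real.add_one_le_exp (-(θ * m / (2 * K)))
          have h3 : θ / (2 * K) * m = θ * m / (2 * K) := by ring
          refine (mul_le_mul_of_nonneg_left (show _ ≤ Real.exp (-(θ * m / (2 * K))) by linarith)
            (expN_nonneg fun _ => (Real.exp_pos _).le)).trans ?_
          gcongr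
      _ = _ := by
          rw [← Real.exp_add]
          push_cast
          ring_nf

/-- In dimension five the corrector is large with high probability when the walk is long. -/
lemma exists_xi_lt_le :
    ∃ c : ℝ, 0 < c ∧ ∀ n T : ℕ, 1 ≤ T → ∀ ζ : ℝ, 2 * (T : ℝ) ≤ ζ → 4 * ζ * Real.sqrt T ≤ n →
      probN 5 n (fun s => xi 5 n T s < c * ζ) ≤ T * Real.exp (-c * ζ / T) := by
  classical
  obtain ⟨K, hK, hb⟩ := exists_sqrt_le_expN_goodEnergy
  set c₀ : ℝ := 1 / 25000 with hc₀
  refine ⟨c₀ / (8 * K), by positivity, fun n T hT ζ hζ hn => ?_⟩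
  set c : ℝ := c₀ / (8 * K) with hc
  have hc0 : 0 < c := by positivity
  have hT1 : (1 : ℝ) ≤ T := by exact_mod_cast hT
  have hT0 : (0 : ℝ) < T := by linarith
  have hζ0 : 0 < ζ := by linarith
  set u := Real.sqrt T with hu
  have hu1 : 1 ≤ u := Real.one_le_sqrt.2 hT1
  have hu2 : u * u = T := Real.mul_self_sqrt hT0.le
  have hn8 : 8 * (T : ℝ) ≤ n := by nlinarith
  have hTn : T ≤ n := by
    have : (T : ℝ) ≤ n := by linarith
    exact_mod_cast this
  set θ : ℝ := 1 / (2 * (T + 1)) with hθ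
  have hθ0 : 0 < θ := by positivity
  have hθT : θ * (T + 1) ≤ 1 / 2 := by rw [hθ]; field_simp; exact le_rfl
  have hθ4 : 1 / (4 * T) ≤ θ := by
    exact one_div_le_one_div_of_le (by positivity) (by linarith)
  set Z : ℕ → (ℕ → V 5) → ℝ := fun j s =>
    ∑ l ∈ range ((n - j) / T), cmp 5 T s (j + (l + 1) * T) with hZ
  have hpt : ∀ s : ℕ → V 5, (if xi 5 n T s < c * ζ then (1 : ℝ) else 0) ≤
      ∑ j ∈ range T, Real.exp (θ * (c * ζ)) * Real.exp (-(θ * Z j s)) := by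
    intro s
    split_ifs with h
    · rw [xi_eq, div_lt_iff₀ hT0] at h
      have h3 := sum_residues_le hT n (cmp_nonneg (T := T) (d := 5) le_rfl s) hTn
      have hsum : ∑ j ∈ range T, Z j s < T * (c * ζ) := by
        refine lt_of_le_of_lt ?_ ((h3.trans_lt h).trans_eq (mul_comm _ _))
        refine Finset.sum_le_sum fun j _ => ?_
        rw [Finset.sum_range_succ']
        have := cmp_nonneg (T := T) (d := 5) le_rfl s (j + 0 * T)
        simp only [hZ]
        linarith
      obtain ⟨j, hj, hjZ⟩ : ∃ j ∈ range T, Z j s ≤ c * ζ := by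
        by_contra! hcon
        have := Finset.sum_le_sum fun j hj => (hcon j hj).le
        rw [Finset.sum_const, Finset.card_range, nsmul_eq_mul] at this
        linarith
      refine le_trans ?_ (Finset.single_le_sum (f := fun j =>
        Real.exp (θ * (c * ζ)) * Real.exp (-(θ * Z j s))) (fun j _ => by positivity) hj)
      rw [← Real.exp_add]
      refine Real.one_le_exp ?_
      have := mul_le_mul_of_nonneg_left hjZ hθ0.le
      linarith
    · exact Finset.sum_nonneg fun j _ => by positivity
  rw [probN_eq]
  refine (expN_mono fun s => (hpt s).trans_eq' (by congr)).trans ?_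
  rw [expN_sum]
  calc _ ≤ ∑ j ∈ range T, Real.exp (-c * ζ / T) := by
        refine Finset.sum_le_sum fun j hj => ?_
        rw [Finset.mem_range] at hj
        have hjn : j + (n - j) / T * T ≤ n := by
          have := Nat.div_mul_le_self (n - j) T
          omega
        have hq : (n : ℝ) / (2 * T) ≤ ((n - j) / T : ℕ) := by
          have h1 : n - j < ((n - j) / T + 1) * T := by
            rw [add_mul, one_mul]; exact Nat.lt_div_mul_add hT
          have h2 : n < ((n - j) / T + 1) * T + T := by omega
          have h3 : (n : ℝ) < ((((n - j) / T : ℕ) : ℝ) + 1) * T + T := by exact_mod_cast h2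
          rw [div_le_iff₀ (by positivity)]
          nlinarith
        have hloc := expN_exp_neg_cmp_le (d := 5) le_rfl hK (hb T hT) hθ0.le hθT j ((n - j) / T)
        set Q : ℕ := (n - j) / T with hQ
        have hl : ∀ s t, Z j (joinSteps (j + Q * T) s t) = Z j s := by
          intro s t
          refine Finset.sum_congr rfl fun l hl => cmp_join_le ?_ s t
          rw [Finset.mem_range] at hl
          have : (l + 1) * T ≤ Q * T := Nat.mul_le_mul_right T hl
          omega
        have hof : expN 5 n (fun s => Real.exp (-(θ * Z j s))) =
            expN 5 (j + Q * T) (fun s => Real.exp (-(θ * Z j s))) :=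
          expN_of_local (by norm_num) (fun s t => by rw [hl]) hjn
        rw [expN_const_mul, hof]
        refine (mul_le_mul_of_nonneg_left hloc (Real.exp_pos _).le).trans ?_
        rw [← Real.exp_add]
        refine Real.exp_le_exp.2 ?_
        have h1 : 2 * ζ ≤ u * Q := by
          calc 2 * ζ = u * (4 * ζ * u / (2 * (u * u))) := by field_simp; norm_num
            _ ≤ u * (n / (2 * (u * u))) := by gcongr
            _ ≤ u * Q := by rw [hu2]; gcongr
        have h2 : θ * (c₀ * u) / (2 * K) * Q = θ * c * 4 * (u * Q) := by
          rw [hc]; field_simp; ring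
        have h3 : θ * c * 4 * (2 * ζ) ≤ θ * c * 4 * (u * Q) := by gcongr
        have h4 : 1 / (4 * T) * (c * ζ) ≤ θ * (c * ζ) := by gcongr
        have h5 : -c * ζ / T = -(4 * (1 / (4 * T) * (c * ζ))) := by field_simp
        have h6 : 0 ≤ θ * (c * ζ) := by positivity
        rw [h5, neg_mul, h2]
        linarith
    _ = _ := by rw [Finset.sum_const, Finset.card_range, nsmul_eq_mul]

lemma probN_le_add {d n : ℕ} {P Q R : (ℕ → V d) → Prop} (h : ∀ s, P s → Q s ∨ R s) :
    probN d n P ≤ probN d n Q + probN d n R := by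
  classical
  simp only [probN_eq, ← expN_add]
  refine expN_mono fun s => ?_
  have := h s
  split_ifs <;> simp_all

lemma probN_mono {d n : ℕ} {P Q : (ℕ → V d) → Prop} (h : ∀ s, P s → Q s) :
    probN d n P ≤ probN d n Q := by
  classical
  simp only [probN_eq]
  refine expN_mono fun s => ?_
  have := h s
  split_ifs <;> simp_all

/-- A downward deviation with a small corrector is unlikely, when the walk is longer than `T`. -/
lemma exists_probN_deviation_le {d : ℕ} (hd : 5 ≤ d) :
    ∃ c : ℝ, 0 < c ∧ ∀ n T : ℕ, 1 ≤ T → T ≤ n → ∀ ζ : ℝ, 2 * (T : ℝ) ≤ ζ →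
      (n : ℝ) ≤ 2 * (ζ * T) →
      probN d n (fun s => cap (rng 0 s n) - expCapRange d n ≤ -ζ ∧ xi d n T s < c * ζ) ≤
        T * Real.exp (-c * ζ / T) := by
  rcases hd.eq_or_lt with rfl | hd6
  · obtain ⟨K, hK, hvar⟩ := exists_varCap_le (d := 5) le_rfl
    obtain ⟨c₁, hc₁, h₁⟩ := exists_deviation_le (d := 5) le_rfl (K := 5 * K) (by positivity)
    obtain ⟨c₂, hc₂, h₂⟩ := exists_xi_lt_le
    refine ⟨min c₁ c₂, lt_min hc₁ hc₂, fun n T hT hTn ζ hζ hn => ?_⟩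
    have hT1 : (1 : ℝ) ≤ T := by exact_mod_cast hT
    have hζ0 : 0 < ζ := by linarith
    have hmono : ∀ c', min c₁ c₂ ≤ c' →
        (T : ℝ) * Real.exp (-c' * ζ / T) ≤ T * Real.exp (-min c₁ c₂ * ζ / T) := by
      intro c' hc'
      gcongr
    rcases le_total (4 * ζ * Real.sqrt T) n with hlong | hshort
    · refine le_trans ?_ ((h₂ n T hT ζ hζ hlong).trans (hmono c₂ (min_le_right _ _)))
      exact probN_mono fun s hs => hs.2.trans_le (by gcongr; exact min_le_right _ _)
    · refine le_trans ?_ ((h₁ n T hT hTn ζ (K * (T * Real.sqrt T)) hζ0 (hvar T hT) ?_).trans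
        (hmono c₁ (min_le_left _ _)))
      · exact probN_mono fun s hs => ⟨hs.1, hs.2.trans_le (by gcongr; exact min_le_left _ _)⟩
      · set u := Real.sqrt T with hu
        have hu1 : 1 ≤ u := Real.one_le_sqrt.2 hT1
        have hu2 : u * u = T := Real.mul_self_sqrt (by linarith)
        have h3 : (n : ℝ) + 2 * T ≤ 5 * (ζ * u) := by nlinarith
        calc ((n : ℝ) / T + 2) * (K * (T * u)) = K * u * (n + 2 * T) := by field_simp
          _ ≤ K * u * (5 * (ζ * u)) := by gcongr
          _ = 5 * K * (ζ * (u * u)) := by ring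
          _ = 5 * K * (ζ * T) := by rw [hu2]
  · obtain ⟨K, hK, hvar⟩ := exists_varCap_le_of_six (d := d) hd6
    obtain ⟨c, hc, h⟩ := exists_deviation_le (d := d) hd (K := 3 * K) (by positivity)
    refine ⟨c, hc, fun n T hT hTn ζ hζ hn => ?_⟩
    have hT1 : (1 : ℝ) ≤ T := by exact_mod_cast hT
    refine h n T hT hTn ζ (K * T) (by linarith) (hvar T hT) ?_
    calc ((n : ℝ) / T + 2) * (K * T) = K * (n + 2 * T) := by field_simp
      _ ≤ K * (3 * (ζ * T)) := by
        gcongr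
        nlinarith
      _ = _ := by ring

/-- Transfer of downward deviations of `Cap(R_n)` to upward deviations of the
corrector: for `d ≥ 5` there is `c > 0` such that for `n ≥ 2`, `ζ > 0`, `T ≥ 1`
with `T ≤ ζ/2` and `ζ ≥ n log n / T`,
`P(Cap(R_n) - E[Cap(R_n)] ≤ -ζ) ≤ 2T exp(-cζ/T) + P(ξ_n(T) ≥ cζ)`. -/
theorem downward_deviation_transfer {d : ℕ} (hd : 5 ≤ d) :
    ∃ c : ℝ, 0 < c ∧ ∀ n : ℕ, 2 ≤ n → ∀ ζ : ℝ, 0 < ζ → ∀ T : ℕ, 1 ≤ T →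
      (T : ℝ) ≤ ζ / 2 → (n : ℝ) * Real.log n / T ≤ ζ →
      probN d n (fun s => cap (rangeOn 0 s (Finset.Icc 0 n)) - expCapRange d n ≤ -ζ) ≤
        2 * T * Real.exp (-c * ζ / T) + probN d n (fun s => c * ζ ≤ xi d n T s) := by
  classical
  have hd0 : 0 < d := by omega
  obtain ⟨c, hc, h⟩ := exists_probN_deviation_le hd
  refine ⟨c, hc, fun n hn ζ hζ T hT hTζ hlog => ?_⟩
  have hT0 : (0 : ℝ) < T := by exact_mod_cast hT
  have hn2 : (2 : ℝ) ≤ n := by exact_mod_cast hn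
  have hexp : (T : ℝ) * Real.exp (-c * ζ / T) ≤ 2 * T * Real.exp (-c * ζ / T) := by
    gcongr
    linarith
  refine (probN_le_add (Q := fun s => cap (rng 0 s n) - expCapRange d n ≤ -ζ ∧
    xi d n T s < c * ζ) (R := fun s => c * ζ ≤ xi d n T s) fun s hs => ?_).trans
    (add_le_add_left (le_trans ?_ hexp) _)
  · exact (lt_or_ge (xi d n T s) (c * ζ)).imp (fun h => ⟨hs, h⟩) id
  rcases le_or_gt T n with hTn | hTn
  · refine h n T hT hTn ζ (by linarith) ?_
    rw [div_le_iff₀ hT0] at hlog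
    have h1 : Real.log 2 ≤ Real.log n := Real.log_le_log (by norm_num) hn2
    have h2 := Real.log_two_gt_d9
    nlinarith
  · have hμ : expCapRange d n ≤ n + 1 := (expN_mono fun t => cap_rng_le 0 t).trans
      (expN_const hd0 _).le
    have hnT : (n : ℝ) + 1 ≤ T := by exact_mod_cast hTn
    calc _ ≤ probN d n (fun _ => False) := probN_mono fun s hs => by
          have h1 := cap_nonneg (rng 0 s n)
          linarith [hs.1]
      _ = 0 := by simp [probN]
      _ ≤ _ := by positivity

end SRW
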